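/- Let (R,𝔪) be a Cohen-Macaulay local ring with canonical module that is generically Gorenstein and not Gorenstein, let ω be a canonical ideal of R, and let x ∈ ω be an R-regular element. Then exactly one of the following holds: (1) X_{ω/xR} ≅ X^{R/ω} ≅ X^R; (2) X_{ω/xR} ≅ X^{R/ω} ≅ ω ⊕ X^R; (3) X_{ω/xR} ≅ ω ⊕ X^{R/ω} ≅ ω ⊕ X^R. Here X_M denotes the MCM part of the minimal MCM approximation of M and X^M the MCM part of the minimal FID hull of M. -/

import Mathlib

open CategoryTheory

noncomputable section

/-- The Ext module `Ext^n_R(M, N)` for `R`-modules `M`, `N`. -/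
abbrev ModExt (R : Type) [CommRing R] (n : ℕ) (M N : ModuleCat R) : ModuleCat R :=
  ((Ext R (ModuleCat R) n).obj (Opposite.op M)).obj N

/-- An `R`-module `M` has finite injective dimension if `Ext^i_R(-, M)` vanishes
for all `i` beyond some bound. -/
def HasFiniteInjDim (R : Type) [CommRing R] (M : ModuleCat R) : Prop :=
  ∃ n : ℕ, ∀ (N : ModuleCat R) (i : ℕ), n < i → Subsingleton (ModExt R i N M)

/-- The depth of a module over a local ring, via Rees' characterization:
the least `n` with `Ext^n(k, M) ≠ 0`. -/
def moduleDepth (R : Type) [CommRing R] [IsLocalRing R] (M : ModuleCat R) : ℕ∞ :=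
  sInf {n : ℕ∞ | ∃ m : ℕ, n = (m : ℕ∞) ∧
    Nontrivial (ModExt R m (ModuleCat.of R (IsLocalRing.ResidueField R)) M)}

/-- A Noetherian local ring is Cohen-Macaulay if its depth equals its Krull dimension. -/
def IsCMLocalRing (R : Type) [CommRing R] [IsLocalRing R] : Prop :=
  IsNoetherianRing R ∧
    (moduleDepth R (ModuleCat.of R R) : WithBot ℕ∞) = ringKrullDim R

/-- A maximal Cohen-Macaulay module: finitely generated with depth equal to `dim R`. -/
def IsMCM (R : Type) [CommRing R] [IsLocalRing R] (X : ModuleCat R) : Prop :=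
  Module.Finite R X ∧ (moduleDepth R X : WithBot ℕ∞) = ringKrullDim R

/-- A Cohen-Macaulay module of codimension one:
`depth M = dim M = dim R - 1`. -/
def IsCMofCodimOne (R : Type) [CommRing R] [IsLocalRing R] (M : ModuleCat R) : Prop :=
  Module.Finite R M ∧ ∃ d : ℕ, ringKrullDim R = ((d + 1 : ℕ) : WithBot ℕ∞) ∧
    moduleDepth R M = (d : ℕ∞) ∧
    ringKrullDim (R ⧸ Module.annihilator R M) = ((d : ℕ) : WithBot ℕ∞)

/-- A Gorenstein local ring: Noetherian local with finite injective dimension over itself. -/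
def IsGorensteinLocalRing (A : Type) [CommRing A] : Prop :=
  IsNoetherianRing A ∧ IsLocalRing A ∧ HasFiniteInjDim A (ModuleCat.of A A)

/-- `R` is generically Gorenstein if its localization at every minimal prime is Gorenstein. -/
def IsGenericallyGorenstein (R : Type) [CommRing R] : Prop :=
  ∀ p ∈ minimalPrimes R, ∀ h : p.IsPrime,
    letI := h
    IsGorensteinLocalRing (Localization.AtPrime p)

/-- A canonical module of a local ring `R`: finitely generated, of finite injective
dimension, with `Ext^i(k, ω) ≅ k` for `i = dim R` and `Ext^i(k, ω) = 0` otherwise. -/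
def IsCanonicalModule (R : Type) [CommRing R] [IsLocalRing R] (W : ModuleCat R) : Prop :=
  Module.Finite R W ∧ HasFiniteInjDim R W ∧
    ∃ d : ℕ, ringKrullDim R = (d : ℕ) ∧
      Nonempty ((ModExt R d (ModuleCat.of R (IsLocalRing.ResidueField R)) W) ≃ₗ[R]
        IsLocalRing.ResidueField R) ∧
      ∀ i : ℕ, i ≠ d →
        Subsingleton (ModExt R i (ModuleCat.of R (IsLocalRing.ResidueField R)) W)

/-- A canonical ideal: an ideal of `R` which, as an `R`-module, is a canonical module. -/
def IsCanonicalIdeal (R : Type) [CommRing R] [IsLocalRing R] (I : Ideal R) : Prop :=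
  IsCanonicalModule R (ModuleCat.of R I)

/-- `Y` and `X` have a common nonzero direct summand via the map `ι : Y → X`. -/
def HasCommonSummandVia (R : Type) [CommRing R] {Y X : ModuleCat R}
    (ι : Y →ₗ[R] X) : Prop :=
  ∃ (N Y' X' : ModuleCat.{0} R), Nontrivial N ∧
    ∃ (e : Y ≃ₗ[R] N × Y') (f : X ≃ₗ[R] N × X') (ι' : Y' →ₗ[R] X'),
      ∀ y : Y, f (ι y) = ((e y).1, ι' (e y).2)

/-- `0 → Y → X → M → 0` is an MCM approximation of `M`. -/
def IsMCMApprox (R : Type) [CommRing R] [IsLocalRing R] (M Y X : ModuleCat R)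
    (ι : Y →ₗ[R] X) (π : X →ₗ[R] M) : Prop :=
  Module.Finite R M ∧ Module.Finite R Y ∧ IsMCM R X ∧ HasFiniteInjDim R Y ∧
    Function.Injective ι ∧ Function.Surjective π ∧ Function.Exact ι π

/-- `0 → Y → X → M → 0` is a minimal MCM approximation of `M`. -/
def IsMinMCMApprox (R : Type) [CommRing R] [IsLocalRing R] (M Y X : ModuleCat R)
    (ι : Y →ₗ[R] X) (π : X →ₗ[R] M) : Prop :=
  IsMCMApprox R M Y X ι π ∧ ¬ HasCommonSummandVia R ι

/-- `0 → M → Y → X → 0` is an FID hull of `M`. -/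
def IsFIDHull (R : Type) [CommRing R] [IsLocalRing R] (M Y X : ModuleCat R)
    (ι : M →ₗ[R] Y) (π : Y →ₗ[R] X) : Prop :=
  Module.Finite R M ∧ Module.Finite R Y ∧ HasFiniteInjDim R Y ∧
    (IsMCM R X ∨ Subsingleton X) ∧
    Function.Injective ι ∧ Function.Surjective π ∧ Function.Exact ι π

/-- `0 → M → Y → X → 0` is a minimal FID hull of `M`. -/
def IsMinFIDHull (R : Type) [CommRing R] [IsLocalRing R] (M Y X : ModuleCat R)
    (ι : M →ₗ[R] Y) (π : Y →ₗ[R] X) : Prop :=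
  IsFIDHull R M Y X ι π ∧ ¬ HasCommonSummandVia R π

/-- The free rank of a module: the largest `m` with `R^m` a direct summand. -/
def freeRank (R : Type) [CommRing R] (X : ModuleCat R) : ℕ∞ :=
  sSup {n : ℕ∞ | ∃ m : ℕ, n = (m : ℕ∞) ∧
    ∃ X' : ModuleCat.{0} R, Nonempty (X ≃ₗ[R] ((Fin m → R) × X'))}

/-- The `W`-rank of a module: the largest `m` with `W^m` a direct summand. -/
def wRank (R : Type) [CommRing R] (W X : ModuleCat R) : ℕ∞ :=
  sSup {n : ℕ∞ | ∃ m : ℕ, n = (m : ℕ∞) ∧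
    ∃ X' : ModuleCat.{0} R, Nonempty (X ≃ₗ[R] ((Fin m → W) × X'))}

/-- `M` and `N` are `W`-stably isomorphic. -/
def WStablyIso (R : Type) [CommRing R] (W M N : ModuleCat R) : Prop :=
  ∃ s t : ℕ, Nonempty ((M × (Fin s → W)) ≃ₗ[R] (N × (Fin t → W)))

/-- The quotient module `I/J` (realized as `I` modulo the elements of `J` lying in `I`). -/
abbrev qmod (R : Type) [CommRing R] (I J : Ideal R) : ModuleCat R :=
  ModuleCat.of R (I ⧸ (Submodule.comap I.subtype J))

section Homological
open Abelian

section Comparison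
variable {R : Type} [CommRing R]

theorem extMk_smul {X Y : ModuleCat.{0} R} (P : ProjectiveResolution X) {n : ℕ}
    (r : R) (f : P.complex.X n ⟶ Y) (hf : P.complex.d (n + 1) n ≫ f = 0) :
    P.extMk (r • f) (n + 1) rfl (by simp [hf]) = r • P.extMk f (n + 1) rfl hf := by
  rw [Ext.smul_eq_comp_mk₀, ProjectiveResolution.extMk_comp_mk₀]
  congr 1

theorem extMk_zero_eq_zero_iff {X Y : ModuleCat.{0} R} (P : ProjectiveResolution X)
    (f : P.complex.X 0 ⟶ Y) (hf : P.complex.d 1 0 ≫ f = 0) :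
    P.extMk f 1 rfl hf = 0 ↔ f = 0 := by
  refine ⟨fun h ↦ ?_, fun h ↦ by subst h; simp⟩
  rw [← P.extEquivCohomologyClass.apply_eq_iff_eq,
    ProjectiveResolution.extEquivCohomologyClass_extMk,
    ProjectiveResolution.extEquivCohomologyClass_zero,
    CochainComplex.HomComplex.CohomologyClass.mk_eq_zero_iff,
    CochainComplex.HomComplex.Cocycle.toSingleMk_mem_coboundaries_iff _ _ _ _ _ 1 (by simp)] at h
  obtain ⟨g, hg⟩ := h
  have : IsIso (P.cochainComplexXIso (-(0 : ℕ)) 0 rfl).hom := inferInstance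
  rw [← cancel_epi (P.cochainComplexXIso (-(0 : ℕ)) 0 rfl).hom, ← hg]
  have h0 : Limits.IsZero (P.cochainComplex.X 1) :=
    P.cochainComplex.isZero_of_isStrictlyLE 0 1 (by simp)
  rw [h0.eq_zero_of_src g]; simp

/-- The linear map sending a cocycle of a projective resolution to its `Ext` class. -/
def cocycleToExt {X : ModuleCat.{0} R} (P : ProjectiveResolution X) (Y : ModuleCat.{0} R) (n : ℕ) :
    LinearMap.ker ((P.complex.linearYonedaObj R Y).d n (n + 1)).hom →ₗ[R] Ext X Y n where
  toFun f := P.extMk f.1 (n + 1) rfl f.2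
  map_add' f g := (P.add_extMk _ _ _ _ f.2 g.2).symm
  map_smul' r f := extMk_smul P r f.1 f.2

theorem modExt_nonempty_linearEquiv (X Y : ModuleCat.{0} R) (n : ℕ) :
    Nonempty (ModExt R n X Y ≃ₗ[R] Ext X Y n) := by
  let P := projectiveResolution X
  let C := P.complex.linearYonedaObj R Y
  let e₁ := (P.isoExt (R := R) n Y).toLinearEquiv
  let S := C.sc' (n - 1) n (n + 1)
  let φ : LinearMap.ker S.g.hom →ₗ[R] Ext X Y n := cocycleToExt P Y n
  have hs : Function.Surjective φ := fun α ↦ by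
    obtain ⟨f, hf, rfl⟩ := P.extMk_surjective α (n + 1) rfl
    exact ⟨⟨f, hf⟩, rfl⟩
  have hk : LinearMap.ker φ = LinearMap.range S.moduleCatToCycles := by
    ext f
    rw [LinearMap.mem_ker, LinearMap.mem_range]
    obtain _ | m := n
    · have h0 : S.f = 0 := C.shape 0 0 (by simp)
      refine (extMk_zero_eq_zero_iff P f.1 f.2).trans ⟨fun h ↦ ⟨0, ?_⟩, ?_⟩
      · rw [map_zero]; exact Subtype.ext h.symm
      · rintro ⟨y, rfl⟩
        change S.f.hom y = 0
        rw [h0]; rfl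
    · refine (P.extMk_eq_zero_iff f.1 (m + 2) rfl f.2 m rfl).trans ⟨?_, ?_⟩
      · rintro ⟨g, hg⟩
        exact ⟨g, Subtype.ext hg⟩
      · rintro ⟨g, hg⟩
        exact ⟨g, congrArg Subtype.val hg⟩
  have hp : (ComplexShape.up ℕ).prev n = n - 1 := by
    cases n <;> simp
  let e₂ := (C.homologyIsoSc' (n - 1) n (n + 1) hp (by simp)).toLinearEquiv
  let e₃ : S.homology ≃ₗ[R] (LinearMap.ker S.g.hom ⧸ LinearMap.range S.moduleCatToCycles) :=
    S.moduleCatHomologyIso.toLinearEquiv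
  exact ⟨e₁.trans (e₂.trans (e₃.trans ((Submodule.quotEquivOfEq _ _ hk.symm).trans
    (φ.quotKerEquivOfSurjective hs))))⟩

end Comparison

section Vanishing
variable {R : Type} [CommRing R]

theorem ext_mid_of_covariant {S : ShortComplex (ModuleCat.{0} R)} (hS : S.ShortExact)
    (X : ModuleCat.{0} R) (n : ℕ) (h₁ : Subsingleton (Ext X S.X₁ n))
    (h₃ : Subsingleton (Ext X S.X₃ n)) : Subsingleton (Ext X S.X₂ n) := by
  refine subsingleton_of_forall_eq 0 fun e ↦ ?_
  obtain ⟨x, rfl⟩ := Ext.covariant_sequence_exact₂ X hS e (Subsingleton.elim _ _)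
  rw [Subsingleton.elim x 0, Ext.zero_comp]

theorem ext_left_of_covariant {S : ShortComplex (ModuleCat.{0} R)} (hS : S.ShortExact)
    (X : ModuleCat.{0} R) (n : ℕ) (h₃ : Subsingleton (Ext X S.X₃ n))
    (h₂ : Subsingleton (Ext X S.X₂ (n + 1))) : Subsingleton (Ext X S.X₁ (n + 1)) := by
  refine subsingleton_of_forall_eq 0 fun e ↦ ?_
  obtain ⟨x, rfl⟩ := Ext.covariant_sequence_exact₁ X hS e (Subsingleton.elim _ _) rfl
  rw [Subsingleton.elim x 0, Ext.zero_comp]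

theorem ext_right_of_covariant {S : ShortComplex (ModuleCat.{0} R)} (hS : S.ShortExact)
    (X : ModuleCat.{0} R) (n : ℕ) (h₂ : Subsingleton (Ext X S.X₂ n))
    (h₁ : Subsingleton (Ext X S.X₁ (n + 1))) : Subsingleton (Ext X S.X₃ n) := by
  refine subsingleton_of_forall_eq 0 fun e ↦ ?_
  obtain ⟨x, rfl⟩ := Ext.covariant_sequence_exact₃ X hS e rfl (Subsingleton.elim _ _)
  rw [Subsingleton.elim x 0, Ext.zero_comp]

theorem ext_mid_of_contravariant {S : ShortComplex (ModuleCat.{0} R)} (hS : S.ShortExact)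
    (Y : ModuleCat.{0} R) (n : ℕ) (h₁ : Subsingleton (Ext S.X₁ Y n))
    (h₃ : Subsingleton (Ext S.X₃ Y n)) : Subsingleton (Ext S.X₂ Y n) := by
  refine subsingleton_of_forall_eq 0 fun e ↦ ?_
  obtain ⟨x, rfl⟩ := Ext.contravariant_sequence_exact₂ hS Y e (Subsingleton.elim _ _)
  rw [Subsingleton.elim x 0, Ext.comp_zero]

theorem ext_left_of_contravariant {S : ShortComplex (ModuleCat.{0} R)} (hS : S.ShortExact)
    (Y : ModuleCat.{0} R) (n : ℕ) (h₂ : Subsingleton (Ext S.X₂ Y n))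
    (h₃ : Subsingleton (Ext S.X₃ Y (n + 1))) : Subsingleton (Ext S.X₁ Y n) := by
  refine subsingleton_of_forall_eq 0 fun e ↦ ?_
  obtain ⟨x, rfl⟩ := Ext.contravariant_sequence_exact₁ hS Y e (add_comm 1 n)
    (Subsingleton.elim _ _)
  rw [Subsingleton.elim x 0, Ext.comp_zero]

theorem ext_right_of_contravariant {S : ShortComplex (ModuleCat.{0} R)} (hS : S.ShortExact)
    (Y : ModuleCat.{0} R) (n : ℕ) (h₁ : Subsingleton (Ext S.X₁ Y n))
    (h₂ : Subsingleton (Ext S.X₂ Y (n + 1))) : Subsingleton (Ext S.X₃ Y (n + 1)) := by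
  refine subsingleton_of_forall_eq 0 fun e ↦ ?_
  obtain ⟨x, rfl⟩ := Ext.contravariant_sequence_exact₃ hS Y e (Subsingleton.elim _ _)
    (add_comm 1 n)
  rw [Subsingleton.elim x 0, Ext.comp_zero]

/-- The short complex of modules attached to an exact pair of linear maps. -/
abbrev exactComplex {A B C : Type} [AddCommGroup A] [AddCommGroup B] [AddCommGroup C]
    [Module R A] [Module R B] [Module R C] (f : A →ₗ[R] B) (g : B →ₗ[R] C)
    (h : Function.Exact f g) : ShortComplex (ModuleCat.{0} R) :=
  ModuleCat.shortComplexOfCompEqZero f g h.linearMap_comp_eq_zero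

theorem exactComplex_shortExact {A B C : Type} [AddCommGroup A] [AddCommGroup B] [AddCommGroup C]
    [Module R A] [Module R B] [Module R C] {f : A →ₗ[R] B} {g : B →ₗ[R] C}
    (h : Function.Exact f g) (hf : Function.Injective f) (hg : Function.Surjective g) :
    (exactComplex f g h).ShortExact :=
  ModuleCat.shortComplex_shortExact _ h hf hg

theorem subsingleton_ext_of_retract {X Y Y' : ModuleCat.{0} R} {n : ℕ} (i : Y' ⟶ Y) (p : Y ⟶ Y')
    (h : i ≫ p = 𝟙 Y') (hY : Subsingleton (Ext X Y n)) : Subsingleton (Ext X Y' n) := by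
  refine subsingleton_of_forall_eq 0 fun e ↦ ?_
  rw [← Ext.comp_mk₀_id e, ← h, ← Ext.mk₀_comp_mk₀, ← Ext.comp_assoc_of_second_deg_zero,
    Subsingleton.elim (e.comp _ _) 0, Ext.zero_comp]

theorem subsingleton_ext_of_linearEquiv_left {X X' : ModuleCat.{0} R} {Y : ModuleCat.{0} R} {n : ℕ}
    (e : X ≃ₗ[R] X') (h : Subsingleton (Ext X' Y n)) : Subsingleton (Ext X Y n) := by
  refine subsingleton_of_forall_eq 0 fun a ↦ ?_
  have : (Ext.mk₀ (e.toModuleIso.hom)).comp ((Ext.mk₀ e.toModuleIso.inv).comp a (zero_add n))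
    (zero_add n) = a := by
    rw [Ext.mk₀_comp_mk₀_assoc, e.toModuleIso.hom_inv_id, Ext.mk₀_id_comp]
  rw [← this, Subsingleton.elim ((Ext.mk₀ e.toModuleIso.inv).comp a (zero_add n)) 0, Ext.comp_zero]

theorem subsingleton_ext_of_subsingleton_right {X Y : ModuleCat.{0} R} (n : ℕ) (h : Subsingleton Y) :
    Subsingleton (Ext X Y n) := by
  refine subsingleton_of_forall_eq 0 fun a ↦ ?_
  have : 𝟙 Y = 0 := by ext x; exact Subsingleton.elim (α := Y) _ _
  rw [← Ext.comp_mk₀_id a, this]; simp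

theorem subsingleton_ext_of_subsingleton_left {X Y : ModuleCat.{0} R} (n : ℕ) (h : Subsingleton X) :
    Subsingleton (Ext X Y n) := by
  refine subsingleton_of_forall_eq 0 fun a ↦ ?_
  have : 𝟙 X = 0 := by ext x; exact Subsingleton.elim (α := X) _ _
  rw [← Ext.mk₀_id_comp a, this]; simp

end Vanishing

section Depth
open IsLocalRing
variable {R : Type} [CommRing R] [IsLocalRing R]

variable (R) in
/-- The residue field as an object of the module category. -/
abbrev resField : ModuleCat.{0} R := ModuleCat.of R (ResidueField R)

theorem smul_resField {r : R} (hr : r ∈ maximalIdeal R) (z : ResidueField R) : r • z = 0 := by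
  rw [Algebra.smul_def]
  have : algebraMap R (ResidueField R) r = 0 := (residue_eq_zero_iff r).2 hr
  rw [this, zero_mul]

theorem smul_id_resField {r : R} (hr : r ∈ maximalIdeal R) : r • 𝟙 (resField R) = 0 := by
  ext z
  exact smul_resField hr z

theorem smul_ext_resField {r : R} (hr : r ∈ maximalIdeal R) {M : ModuleCat.{0} R} {n : ℕ}
    (e : Ext (resField R) M n) : r • e = 0 := by
  rw [← Ext.mk₀_id_comp e, ← Ext.smul_comp, ← Ext.mk₀_smul, smul_id_resField hr]; simp

theorem comp_smul_id_ext_resField {r : R} (hr : r ∈ maximalIdeal R) {M : ModuleCat.{0} R} {n : ℕ}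
    (e : Ext (resField R) M n) : e.comp (Ext.mk₀ (r • 𝟙 M)) (add_zero n) = 0 := by
  rw [← Ext.smul_eq_comp_mk₀, smul_ext_resField hr]

/-- `Ext^i(k, M) = 0` for all `i < t`. -/
def DepthGE (t : ℕ) (M : ModuleCat.{0} R) : Prop :=
  ∀ i < t, Subsingleton (Ext (resField R) M i)

theorem DepthGE.of_retract {t : ℕ} {Y Y' : ModuleCat.{0} R} (h : DepthGE t Y) (i : Y' ⟶ Y)
    (p : Y ⟶ Y') (hip : i ≫ p = 𝟙 Y') : DepthGE t Y' := fun j hj ↦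
  subsingleton_ext_of_retract i p hip (h j hj)

theorem DepthGE.smulQuotient {t : ℕ} {M : ModuleCat.{0} R} (h : DepthGE (t + 1) M) {a : R}
    (ha : IsSMulRegular M a) : DepthGE t (M.smulShortComplex a).X₃ := fun i hi ↦
  ext_right_of_covariant ha.smulShortComplex_shortExact _ i (h i (by omega)) (h (i + 1) (by omega))

instance {M : ModuleCat.{0} R} [Module.Finite R M] (a : R) :
    Module.Finite R (M.smulShortComplex a).X₃ :=
  inferInstanceAs (Module.Finite R (QuotSMulTop a M))

variable [IsNoetherianRing R]

theorem exists_mem_maximalIdeal_isSMulRegular {M : ModuleCat.{0} R} [Module.Finite R M]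
    (h : Subsingleton (Ext (resField R) M 0)) :
    ∃ a ∈ maximalIdeal R, IsSMulRegular M a := by
  have : Subsingleton (ResidueField R →ₗ[R] M) := by
    have h' : Subsingleton (resField R ⟶ M) :=
      (Ext.homEquiv₀ (X := resField R) (Y := M)).symm.subsingleton
    exact (ModuleCat.homEquiv (M := resField R) (N := M)).symm.subsingleton
  obtain ⟨a, ha, hr⟩ := IsSMulRegular.subsingleton_linearMap_iff.1 this
  refine ⟨a, ?_, hr⟩
  rw [Module.mem_annihilator] at ha
  have := ha 1
  rw [Algebra.smul_def, mul_one] at this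
  exact (residue_eq_zero_iff a).1 this

theorem exists_mem_maximalIdeal_isSMulRegular₂ {M N : ModuleCat.{0} R} [Module.Finite R M]
    [Module.Finite R N] (hM : Subsingleton (Ext (resField R) M 0))
    (hN : Subsingleton (Ext (resField R) N 0)) :
    ∃ a ∈ maximalIdeal R, IsSMulRegular M a ∧ IsSMulRegular N a := by
  have hex : Function.Exact (LinearMap.inl R M N) (LinearMap.snd R M N) := by
    exact Function.Exact.inl_snd
  have h := ext_mid_of_covariant (exactComplex_shortExact hex LinearMap.inl_injective
    LinearMap.snd_surjective) (resField R) 0 hM hN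
  obtain ⟨a, ha, hr⟩ := exists_mem_maximalIdeal_isSMulRegular (M := ModuleCat.of R (M × N)) h
  refine ⟨a, ha, fun x y hxy ↦ ?_, fun x y hxy ↦ ?_⟩
  · exact congrArg Prod.fst (@hr (x, 0) (y, 0) (Prod.ext hxy rfl))
  · exact congrArg Prod.snd (@hr (0, x) (0, y) (Prod.ext rfl hxy))

theorem exists_injective_resField {K : Type} [AddCommGroup K] [Module R K] [Module.Finite R K]
    [Nontrivial K] (hdim : Module.supportDim R K ≤ 0) :
    ∃ f : ResidueField R →ₗ[R] K, f ≠ 0 := by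
  have hd : Module.supportDim R K = 0 := by
    refine le_antisymm hdim ?_
    have := Module.supportDim_ne_bot_of_nontrivial R K
    rcases hh : Module.supportDim R K with _ | n
    · exact absurd hh this
    · exact WithBot.coe_le_coe.2 (zero_le)
  obtain ⟨x, hx⟩ := exists_ne (0 : K)
  obtain ⟨P, hP, hle⟩ := exists_le_isAssociatedPrime_of_isNoetherianRing R x hx
  obtain ⟨hPp, z, hz⟩ := isAssociatedPrime_iff.1 hP
  have hPm : P = maximalIdeal R := by
    have : (⟨P, hPp⟩ : PrimeSpectrum R) ∈ Module.support R K := by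
      rw [Module.mem_support_iff_exists_annihilator]
      refine ⟨z, ?_⟩
      intro r hr
      change r ∈ P
      rw [hz, Submodule.mem_colon_singleton]
      exact (Submodule.mem_bot R).2 ((Submodule.mem_annihilator_span_singleton z r).1 hr)
    rw [support_of_supportDim_eq_zero R K hd] at this
    exact le_antisymm (le_maximalIdeal hPp.ne_top) this
  have hker : maximalIdeal R ≤ LinearMap.ker (LinearMap.toSpanSingleton R K z) := by
    intro r hr
    rw [← hPm, hz, Submodule.mem_colon_singleton] at hr
    simpa using hr
  refine ⟨(maximalIdeal R).liftQ (LinearMap.toSpanSingleton R K z) hker, fun h ↦ ?_⟩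
  have h1 : z = 0 := by
    have h2 := LinearMap.congr_fun h ((maximalIdeal R).mkQ 1)
    have h3 : (Submodule.liftQ (maximalIdeal R) (LinearMap.toSpanSingleton R K z) hker)
        ((maximalIdeal R).mkQ 1) = z := by
      rw [Submodule.mkQ_apply, Submodule.liftQ_apply]; simp
    exact h3.symm.trans h2
  apply hPp.ne_top
  rw [hz, h1]
  ext; simp

end Depth

section Injectivity
open IsLocalRing
variable {R : Type} [CommRing R] [IsLocalRing R]

/-- The morphism of multiplication sequences induced by a linear map. -/
def smulShortComplexMap {N W : ModuleCat.{0} R} (g : N ⟶ W) (a : R) :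
    N.smulShortComplex a ⟶ W.smulShortComplex a where
  τ₁ := g
  τ₂ := g
  τ₃ := ModuleCat.ofHom (QuotSMulTop.map a g.hom)
  comm₁₂ := by
    ext x
    exact (map_smul g.hom a x).symm
  comm₂₃ := by
    ext x
    rfl

variable [IsNoetherianRing R]

theorem injective_of_ext_injective (t : ℕ) : ∀ (N W : ModuleCat.{0} R) [Module.Finite R N]
    [Module.Finite R W] (g : N ⟶ W), DepthGE t N → DepthGE t W →
    Module.supportDim R N ≤ (t : WithBot ℕ∞) →
    (∀ e : Ext (resField R) N t, e.comp (Ext.mk₀ g) (add_zero t) = 0 → e = 0) →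
    Function.Injective g := by
  induction t with
  | zero =>
    intro N W _ _ g _ _ hdim hg
    by_contra hinj
    have hker : LinearMap.ker g.hom ≠ ⊥ := fun h ↦ hinj (LinearMap.ker_eq_bot.1 h)
    have := Submodule.nontrivial_iff_ne_bot.2 hker
    have hd := (Module.supportDim_le_of_injective (LinearMap.ker g.hom).subtype
      (Submodule.injective_subtype _)).trans hdim
    obtain ⟨f, hf⟩ := exists_injective_resField (R := R) (K := LinearMap.ker g.hom) (by simpa using hd)
    apply hf
    have h := hg (Ext.mk₀ (X := resField R) (ModuleCat.ofHom ((LinearMap.ker g.hom).subtype ∘ₗ f))) (by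
      rw [Ext.mk₀_comp_mk₀, Ext.mk₀_eq_zero_iff]
      ext z
      exact (f z).2)
    rw [Ext.mk₀_eq_zero_iff] at h
    ext z
    exact congrArg (fun q : resField R ⟶ N ↦ q.hom z) h
  | succ t ih =>
    intro N W _ _ g hN hW hdim hg
    obtain ⟨a, ha, haN, haW⟩ := exists_mem_maximalIdeal_isSMulRegular₂ (hN 0 (by omega))
      (hW 0 (by omega))
    have hd : Module.supportDim R (N.smulShortComplex a).X₃ ≤ (t : WithBot ℕ∞) := by
      have h1 := Module.supportDim_quotSMulTop_succ_eq_supportDim haN ha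
      rw [← h1] at hdim
      change Module.supportDim R (QuotSMulTop a N) ≤ _
      push_cast at hdim
      exact (ENat.WithBot.add_le_add_one_right_iff).1 hdim
    have key := ih (N.smulShortComplex a).X₃ (W.smulShortComplex a).X₃
      (smulShortComplexMap g a).τ₃ (hN.smulQuotient haN) (hW.smulQuotient haW) hd (by
        intro e he
        have h1 : (e.comp haN.smulShortComplex_shortExact.extClass rfl).comp (Ext.mk₀ g)
            (add_zero (t + 1)) = 0 := by
          rw [Ext.comp_assoc_of_third_deg_zero]
          have := ShortComplex.ShortExact.extClass_naturality haN.smulShortComplex_shortExact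
            haW.smulShortComplex_shortExact (smulShortComplexMap g a)
          rw [show Ext.mk₀ (smulShortComplexMap g a).τ₁ = Ext.mk₀ g from rfl] at this
          refine (congrArg (fun q ↦ e.comp q (rfl : t + 1 = t + 1)) this).trans ?_
          rw [← Ext.comp_assoc_of_second_deg_zero, he, Ext.zero_comp]
          rfl
        obtain ⟨x, rfl⟩ := Ext.covariant_sequence_exact₃ _ haN.smulShortComplex_shortExact e rfl
          (hg _ h1)
        have := hN t (by omega)
        have hx : x = 0 := Subsingleton.elim (α := Ext (resField R) N t) x 0
        rw [hx, Ext.zero_comp])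
    have hle : LinearMap.ker g.hom ≤ Ideal.span {a} • LinearMap.ker g.hom := by
      intro x hx
      have h0 : (Submodule.Quotient.mk x : QuotSMulTop a N) = Submodule.Quotient.mk 0 := by
        apply key
        change (QuotSMulTop.map a g.hom) (Submodule.Quotient.mk x) =
          (QuotSMulTop.map a g.hom) (Submodule.Quotient.mk 0)
        rw [QuotSMulTop.map_apply_mk, QuotSMulTop.map_apply_mk, LinearMap.mem_ker.1 hx, map_zero]
      rw [Submodule.Quotient.mk_zero, Submodule.Quotient.mk_eq_zero,
        Submodule.mem_smul_pointwise_iff_exists] at h0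
      obtain ⟨y, -, rfl⟩ := h0
      refine Submodule.smul_mem_smul (Ideal.mem_span_singleton_self a) ?_
      rw [LinearMap.mem_ker] at hx ⊢
      apply haW
      change a • g.hom y = a • (0 : W)
      rw [smul_zero, ← map_smul]
      exact hx
    have : LinearMap.ker g.hom = ⊥ := Submodule.eq_bot_of_le_smul_of_le_jacobson_bot
      (Ideal.span {a}) _ (IsNoetherian.noetherian _) hle (by
        rw [jacobson_eq_maximalIdeal ⊥ bot_ne_top, Ideal.span_singleton_le_iff_mem]
        exact ha)
    exact LinearMap.ker_eq_bot.1 this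

theorem subsingleton_of_forall_exists_smul {M : Type} [AddCommGroup M] [Module R M]
    [Module.Finite R M] {a : R} (ha : a ∈ maximalIdeal R) (h : ∀ x : M, ∃ y, a • y = x) :
    Subsingleton M := by
  have : (⊤ : Submodule R M) = ⊥ := Submodule.eq_bot_of_le_smul_of_le_jacobson_bot
      (Ideal.span {a}) _ (IsNoetherian.noetherian _) (fun x _ ↦ by
        obtain ⟨y, rfl⟩ := h x
        exact Submodule.smul_mem_smul (Ideal.mem_span_singleton_self a) trivial) (by
        rw [jacobson_eq_maximalIdeal ⊥ bot_ne_top, Ideal.span_singleton_le_iff_mem]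
        exact ha)
  exact (Submodule.subsingleton_iff R).1 (subsingleton_of_bot_eq_top this.symm)

theorem subsingleton_ext_of_smulQuotient {M Y : ModuleCat.{0} R} [Module.Finite R M]
    [Module.Finite R Y] {a : R} (ha : a ∈ maximalIdeal R) (hr : IsSMulRegular M a) {i : ℕ}
    (h : Subsingleton (Ext (M.smulShortComplex a).X₃ Y (i + 1))) : Subsingleton (Ext M Y i) := by
  refine subsingleton_of_forall_exists_smul ha fun e ↦ ?_
  obtain ⟨y, hy⟩ := Ext.contravariant_sequence_exact₁ hr.smulShortComplex_shortExact Y e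
    (add_comm 1 i) (Subsingleton.elim _ _)
  refine ⟨y, ?_⟩
  have h1 : ∀ y : Ext M Y i, (Ext.mk₀ (a • 𝟙 M)).comp y (zero_add i) = a • y := fun y ↦ by
    rw [Ext.mk₀_smul, Ext.smul_comp, Ext.mk₀_id_comp]
  exact (h1 y).symm.trans hy

end Injectivity

section FiniteInjDim
open IsLocalRing
variable {R : Type} [CommRing R] [IsLocalRing R]

/-- Finite generation together with finite injective dimension. -/
structure IsFID (Y : ModuleCat.{0} R) : Prop where
  finite : Module.Finite R Y
  vanish : ∃ n : ℕ, ∀ (N : ModuleCat.{0} R) (i : ℕ), n < i → Subsingleton (Ext N Y i)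

variable [IsNoetherianRing R]

theorem exists_depth_tower {d : ℕ} (hR : DepthGE d (ModuleCat.of R R))
    (hRd : Nontrivial (Ext (resField R) (ModuleCat.of R R) d)) (t : ℕ) (ht : t ≤ d) :
    ∃ B : ModuleCat.{0} R, Module.Finite R B ∧ DepthGE (d - t) B ∧
      Nontrivial (Ext (resField R) B (d - t)) ∧
      ∀ (V : ModuleCat.{0} R) (i : ℕ), t < i → Subsingleton (Ext B V i) := by
  induction t with
  | zero =>
    refine ⟨ModuleCat.of R R, inferInstance, hR, hRd, fun V i hi ↦ ?_⟩
    obtain ⟨j, rfl⟩ := Nat.exists_eq_succ_of_ne_zero hi.ne'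
    exact Ext.subsingleton_of_projective _ _ j
  | succ t ih =>
    obtain ⟨B, _, hB, hBn, hV⟩ := ih (by omega)
    obtain ⟨s, hs⟩ : ∃ s, d - t = s + 1 := ⟨d - t - 1, by omega⟩
    have hs' : d - (t + 1) = s := by omega
    rw [hs'] 
    rw [hs] at hB hBn
    obtain ⟨a, ha, haB⟩ := exists_mem_maximalIdeal_isSMulRegular (hB 0 (by omega))
    have hS := haB.smulShortComplex_shortExact
    refine ⟨(B.smulShortComplex a).X₃, inferInstance, hB.smulQuotient haB, ?_, fun V i hi ↦ ?_⟩
    · obtain ⟨e, he⟩ := exists_ne (0 : Ext (resField R) B (s + 1))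
      obtain ⟨x, hx⟩ := Ext.covariant_sequence_exact₁ _ hS e
        (comp_smul_id_ext_resField ha e) rfl
      refine ⟨x, 0, fun h ↦ he ?_⟩
      rw [← hx, h, Ext.zero_comp]
      rfl
    · obtain ⟨j, rfl⟩ := Nat.exists_eq_succ_of_ne_zero (show i ≠ 0 by omega)
      exact ext_right_of_contravariant hS V j (hV V j (by omega)) (hV V (j + 1) (by omega))

theorem IsFID.ext_eq_zero {d : ℕ} (hR : DepthGE d (ModuleCat.of R R))
    (hRd : Nontrivial (Ext (resField R) (ModuleCat.of R R) d)) {Y : ModuleCat.{0} R}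
    (hY : IsFID Y) (N : ModuleCat.{0} R) [hN : Module.Finite R N] {i : ℕ} (hi : d < i) :
    Subsingleton (Ext N Y i) := by
  have := hY.finite
  obtain ⟨n, hn⟩ := hY.vanish
  obtain ⟨B, _, _, hBn, hBV⟩ := exists_depth_tower hR hRd d le_rfl
  rw [Nat.sub_self] at hBn
  obtain ⟨e, he⟩ := exists_ne (0 : Ext (resField R) B 0)
  obtain ⟨f, rfl⟩ := Ext.homEquiv₀.symm.surjective e
  have hf : f ≠ 0 := fun h ↦ he (by rw [h]; exact Ext.mk₀_zero _ _)
  have hfinj : Function.Injective f.hom := by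
    let g : ResidueField R →ₗ[R] B := f.hom
    intro x y hxy
    by_contra hne
    apply hf
    have hu : x - y ≠ 0 := sub_ne_zero.2 hne
    have h0 : g (x - y) = 0 := by rw [map_sub]; exact sub_eq_zero.2 hxy
    ext z
    obtain ⟨r, hr⟩ := residue_surjective (z / (x - y))
    have : r • (x - y) = z := by
      rw [Algebra.smul_def]
      change residue R r * (x - y) = z
      rw [hr, div_mul_cancel₀ _ hu]
    change g z = 0
    rw [← this, map_smul, h0, smul_zero]
  have hex : Function.Exact f.hom (LinearMap.range f.hom).mkQ := by
    rw [LinearMap.exact_iff, Submodule.ker_mkQ]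
  have hS := exactComplex_shortExact hex hfinj (Submodule.mkQ_surjective _)
  suffices H : ∀ m i, d < i → n < i + m → ∀ N : ModuleCat.{0} R, Module.Finite R N →
      Subsingleton (Ext N Y i) from H (n + 1) i hi (by omega) N hN
  intro m
  induction m with
  | zero => intro i _ hni N _; exact hn N i hni
  | succ m ih =>
    intro i hdi hni N hN
    have next : ∀ N : ModuleCat.{0} R, Module.Finite R N → Subsingleton (Ext N Y (i + 1)) :=
      ih (i + 1) (by omega) (by omega)
    have hk : Subsingleton (Ext (resField R) Y i) :=
      ext_left_of_contravariant hS Y i (hBV Y i hdi) (next (ModuleCat.of R _) (inferInstanceAs (Module.Finite R (B ⧸ LinearMap.range f.hom))))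
    refine IsNoetherianRing.induction_on_isQuotientEquivQuotientPrime R (M := N) hN
      (motive := fun M _ _ _ ↦ Subsingleton (Ext (ModuleCat.of R M) Y i)) ?_ ?_ ?_
    · intro M _ _ _ hM
      exact subsingleton_ext_of_subsingleton_left i hM
    · intro M _ _ _ p e
      refine subsingleton_ext_of_linearEquiv_left (X := ModuleCat.of R M)
        (X' := ModuleCat.of R (R ⧸ p.asIdeal)) e ?_
      by_cases hp : p.asIdeal = maximalIdeal R
      · rw [hp]; exact hk
      · obtain ⟨a, ha, hap⟩ := SetLike.exists_of_lt
          (lt_of_le_of_ne (le_maximalIdeal p.isPrime.ne_top) hp)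
        refine subsingleton_ext_of_smulQuotient ha ?_ (next _ inferInstance)
        intro x y hxy
        have hz : a • (x - y) = 0 := by rw [smul_sub]; exact sub_eq_zero.2 hxy
        rw [← sub_eq_zero]
        obtain ⟨z, hz'⟩ := Ideal.Quotient.mk_surjective (x - y : R ⧸ p.asIdeal)
        rw [← hz'] at hz ⊢
        rw [Algebra.smul_def] at hz
        rw [Ideal.Quotient.eq_zero_iff_mem]
        have : a * z ∈ p.asIdeal := by
          rw [← Ideal.Quotient.eq_zero_iff_mem, map_mul]; exact hz
        exact (p.isPrime.mem_or_mem this).resolve_left hap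
    · intro M₁ _ _ _ M₂ _ _ _ M₃ _ _ _ f g hf hg hfg h₁ h₃
      exact ext_mid_of_contravariant (exactComplex_shortExact hfg hf hg) Y i h₁ h₃

theorem IsFID.ext_eq_zero_of_depthGE {d : ℕ} (hR : DepthGE d (ModuleCat.of R R))
    (hRd : Nontrivial (Ext (resField R) (ModuleCat.of R R) d)) {Y : ModuleCat.{0} R}
    (hY : IsFID Y) (t : ℕ) : ∀ (M : ModuleCat.{0} R) [Module.Finite R M], DepthGE t M →
    ∀ i, d < i + t → Subsingleton (Ext M Y i) := by
  have := hY.finite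
  induction t with
  | zero => intro M _ _ i hi; exact hY.ext_eq_zero hR hRd M hi
  | succ t ih =>
    intro M _ hM i hi
    obtain ⟨a, ha, haM⟩ := exists_mem_maximalIdeal_isSMulRegular (hM 0 (by omega))
    exact subsingleton_ext_of_smulQuotient ha haM
      (ih _ (hM.smulQuotient haM) (i + 1) (by omega))

end FiniteInjDim

section Pushout
variable {R : Type} [CommRing R]

theorem exists_extClass_eq {A B C N : Type} [AddCommGroup A] [AddCommGroup B] [AddCommGroup C]
    [AddCommGroup N] [Module R A] [Module R B] [Module R C] [Module R N] [Module.Finite R N]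
    [Module.Finite R B] {i : A →ₗ[R] B} {p : B →ₗ[R] C} (h : Function.Exact i p)
    (hi : Function.Injective i) (hp : Function.Surjective p) (φ : A →ₗ[R] N) :
    ∃ (E : ModuleCat.{0} R) (_ : Module.Finite R E) (f : N →ₗ[R] E) (g : E →ₗ[R] C)
      (hfg : Function.Exact f g) (hf : Function.Injective f) (hg : Function.Surjective g),
      (exactComplex_shortExact h hi hp).extClass.comp (Ext.mk₀ (ModuleCat.ofHom φ)) (add_zero 1) =
        (exactComplex_shortExact hfg hf hg).extClass := by
  let K : Submodule R (N × B) := LinearMap.range (φ.prod (-i))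
  have hpi : ∀ a, p (i a) = 0 := fun a ↦ h.apply_apply_eq_zero a
  let f : N →ₗ[R] (N × B) ⧸ K := K.mkQ ∘ₗ LinearMap.inl R N B
  have hK : K ≤ LinearMap.ker (p ∘ₗ LinearMap.snd R N B) := by
    rintro _ ⟨a, rfl⟩
    simp [hpi]
  let g : ((N × B) ⧸ K) →ₗ[R] C := K.liftQ (p ∘ₗ LinearMap.snd R N B) hK
  have hf : Function.Injective f := by
    rw [injective_iff_map_eq_zero]
    intro n hn
    have hn' : ((n, 0) : N × B) ∈ K := (Submodule.Quotient.mk_eq_zero K).1 hn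
    obtain ⟨a, ha⟩ := hn'
    have h1 : φ a = n := congrArg Prod.fst ha
    have h2 : -i a = 0 := congrArg Prod.snd ha
    have h3 : a = 0 := hi (by rw [map_zero]; exact neg_eq_zero.1 h2)
    rw [← h1, h3, map_zero]
  have hg : Function.Surjective g := by
    intro c
    obtain ⟨b, rfl⟩ := hp c
    exact ⟨K.mkQ (0, b), rfl⟩
  have hfg : Function.Exact f g := by
    intro y
    constructor
    · intro hy
      obtain ⟨⟨n, b⟩, rfl⟩ := K.mkQ_surjective y
      obtain ⟨a, ha⟩ := (h b).1 hy
      refine ⟨n + φ a, ?_⟩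
      change Submodule.Quotient.mk _ = Submodule.Quotient.mk _
      rw [Submodule.Quotient.eq]
      exact ⟨a, by ext <;> simp [ha]⟩
    · rintro ⟨n, rfl⟩
      change p 0 = 0
      exact map_zero p
  let m : exactComplex i p h ⟶ exactComplex f g hfg :=
    { τ₁ := ModuleCat.ofHom φ
      τ₂ := ModuleCat.ofHom (K.mkQ ∘ₗ LinearMap.inr R N B)
      τ₃ := 𝟙 _
      comm₁₂ := by
        ext a
        change Submodule.Quotient.mk _ = Submodule.Quotient.mk _
        rw [Submodule.Quotient.eq]
        refine ⟨a, ?_⟩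
        change (φ a, -i a) = ((φ a, 0) : N × B) - (0, i a)
        ext <;> simp
      comm₂₃ := by
        ext b
        rfl }
  refine ⟨ModuleCat.of R ((N × B) ⧸ K), inferInstanceAs (Module.Finite R ((N × B) ⧸ K)), f, g,
    hfg, hf, hg, ?_⟩
  have := ShortComplex.ShortExact.extClass_naturality (exactComplex_shortExact h hi hp)
    (exactComplex_shortExact hfg hf hg) m
  exact this.trans (Ext.mk₀_id_comp _)

theorem ext_pi_eq_zero {X : ModuleCat.{0} R} {M : Type} [AddCommGroup M] [Module R M] {m n : ℕ}
    (e : Ext X (ModuleCat.of R (Fin m → M)) n)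
    (h : ∀ j : Fin m, e.comp (Ext.mk₀ (ModuleCat.ofHom (LinearMap.proj (R := R) (φ := fun _ : Fin m ↦ M) j)))
      (add_zero n) = 0) : e = 0 := by
  have hid : 𝟙 (ModuleCat.of R (Fin m → M)) = ∑ j : Fin m,
      ModuleCat.ofHom (LinearMap.proj (R := R) (φ := fun _ : Fin m ↦ M) j) ≫
        ModuleCat.ofHom (LinearMap.single R (fun _ : Fin m ↦ M) j) := by
    ext x i
    simp [ModuleCat.hom_sum, Finset.sum_apply, Pi.single_apply]
  rw [← Ext.comp_mk₀_id e, hid, Ext.mk₀_sum, Ext.comp_sum]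
  refine Finset.sum_eq_zero fun j _ ↦ ?_
  rw [← Ext.mk₀_comp_mk₀, ← Ext.comp_assoc_of_second_deg_zero, h j, Ext.zero_comp]

theorem subsingleton_ext_pi {X : ModuleCat.{0} R} {M : Type} [AddCommGroup M] [Module R M] (m : ℕ)
    {n : ℕ} (h : Subsingleton (Ext X (ModuleCat.of R M) n)) :
    Subsingleton (Ext X (ModuleCat.of R (Fin m → M)) n) :=
  subsingleton_of_forall_eq 0 fun e ↦ ext_pi_eq_zero e fun _ ↦ Subsingleton.elim _ _

end Pushout

section Syzygy
open IsLocalRing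
variable {R : Type} [CommRing R] [IsLocalRing R]

theorem DepthGE.pi {t : ℕ} {M : Type} [AddCommGroup M] [Module R M] (m : ℕ)
    (h : DepthGE t (ModuleCat.of R M)) : DepthGE t (ModuleCat.of R (Fin m → M)) :=
  fun i hi ↦ subsingleton_ext_pi m (h i hi)

variable [IsNoetherianRing R]

theorem exists_syzygy_resField {d : ℕ} (hR : DepthGE d (ModuleCat.of R R)) (j : ℕ) (hj : j < d) :
    ∃ (Z : ModuleCat.{0} R) (_ : Module.Finite R Z) (θ : Ext (resField R) Z j),
      (∀ (V : ModuleCat.{0} R) (i n : ℕ) (h : j + (i + 1) = n) (ξ : Ext (resField R) V n),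
        ∃ ξ' : Ext Z V (i + 1), θ.comp ξ' h = ξ) ∧
      (∀ (V : ModuleCat.{0} R) (i n : ℕ) (h : j + (i + 1) = n) (ξ' : Ext Z V (i + 1)),
        θ.comp ξ' h = 0 → ξ' = 0) ∧
      DepthGE j Z ∧ ∀ e : Ext (resField R) Z j, ∃ r : R, e = r • θ := by
  induction j with
  | zero =>
    refine ⟨resField R, inferInstance, Ext.mk₀ (𝟙 _), ?_, ?_, ?_, ?_⟩
    · intro V i n h ξ
      obtain rfl : i + 1 = n := by omega
      exact ⟨ξ, Ext.mk₀_id_comp ξ⟩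
    · intro V i n h ξ' h0
      obtain rfl : i + 1 = n := by omega
      exact (Ext.mk₀_id_comp ξ').symm.trans h0
    · intro i hi
      omega
    · intro e
      obtain ⟨f, rfl⟩ := Ext.homEquiv₀.symm.surjective e
      obtain ⟨r, hr⟩ := residue_surjective (R := R) (f.hom (1 : ResidueField R))
      refine ⟨r, ?_⟩
      rw [← Ext.mk₀_smul]
      change Ext.mk₀ f = _
      congr 1
      ext z
      obtain ⟨s, rfl⟩ := residue_surjective (R := R) z
      have h1 : residue R s = s • (1 : ResidueField R) := by
        rw [Algebra.smul_def, mul_one]; rfl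
      have h2 : f.hom (residue R s) = s • f.hom (1 : ResidueField R) := by
        rw [h1, map_smul]
      have h3 : s • residue R r = r • residue R s := by
        rw [Algebra.smul_def, Algebra.smul_def]
        exact mul_comm (residue R s) (residue R r)
      exact h2.trans ((congrArg (s • ·) hr.symm).trans h3)
  | succ j ih =>
    obtain ⟨Z, _, θ, ha, hb, hc, hd⟩ := ih (by omega)
    obtain ⟨n, π, hπ⟩ := Module.Finite.exists_fin' R Z
    have hex : Function.Exact (LinearMap.ker π).subtype π := LinearMap.exact_subtype_ker_map π
    have hS := exactComplex_shortExact hex (Submodule.injective_subtype _) hπ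
    have hP : DepthGE d (ModuleCat.of R (Fin n → R)) := hR.pi n
    have hPV : ∀ (V : ModuleCat.{0} R) (i : ℕ),
        Subsingleton (Ext (ModuleCat.of R (Fin n → R)) V (i + 1)) := fun V i ↦
      Ext.subsingleton_of_projective _ _ i
    refine ⟨ModuleCat.of R (LinearMap.ker π), inferInstance, θ.comp hS.extClass rfl,
      ?_, ?_, ?_, ?_⟩
    · intro V i n h ξ
      obtain ⟨ξ₁, rfl⟩ := ha V (i + 1) n (by omega) ξ
      have := hPV V (i + 1)
      obtain ⟨ξ₂, rfl⟩ := Ext.contravariant_sequence_exact₃ hS V ξ₁ (Subsingleton.elim _ _)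
        (add_comm 1 (i + 1))
      exact ⟨ξ₂, Ext.comp_assoc _ _ _ _ _ (by omega)⟩
    · intro V i n h ξ' h0
      have h1 := hb V (i + 1) n (by omega) (hS.extClass.comp ξ' (add_comm 1 (i + 1)))
        ((Ext.comp_assoc _ _ _ _ _ (by omega)).symm.trans h0)
      have := hPV V i
      obtain ⟨ξ₂, rfl⟩ := Ext.contravariant_sequence_exact₁ hS V ξ' (add_comm 1 (i + 1)) h1
      rw [Subsingleton.elim ξ₂ 0, Ext.comp_zero]
    · intro i hi
      cases i with
      | zero =>
        refine subsingleton_of_forall_eq 0 fun e ↦ ?_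
        obtain ⟨f, rfl⟩ := Ext.homEquiv₀.symm.surjective e
        change Ext.mk₀ f = 0
        have := hP 0 (by omega)
        have h1 : Ext.mk₀ (f ≫ ModuleCat.ofHom (LinearMap.ker π).subtype) = 0 :=
          Subsingleton.elim _ _
        rw [Ext.mk₀_eq_zero_iff] at h1 ⊢
        ext z
        exact congrFun (congrArg (fun q : resField R ⟶ ModuleCat.of R (Fin n → R) ↦ q.hom z) h1) _
      | succ i =>
        exact ext_left_of_covariant hS _ i (hc i (by omega)) (hP (i + 1) (by omega))
    · intro e
      have := hP (j + 1) hj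
      obtain ⟨y, rfl⟩ := Ext.covariant_sequence_exact₁ _ hS e (Subsingleton.elim _ _) rfl
      obtain ⟨r, rfl⟩ := hd y
      exact ⟨r, Ext.smul_comp _ _ _ _⟩

variable (R) in
/-- The data used throughout: a local ring of depth at least `d` and dimension `d`, with a
canonical module `W`. -/
structure CanonicalSetup (d : ℕ) (W : Type) [AddCommGroup W] [Module R W] : Prop where
  pos : 0 < d
  dim : ringKrullDim R = d
  depth_ring : DepthGE d (ModuleCat.of R R)
  ext_ring : Nontrivial (Ext (resField R) (ModuleCat.of R R) d)
  fid : IsFID (ModuleCat.of R W)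
  depth : DepthGE d (ModuleCat.of R W)
  simple : Nonempty (Ext (resField R) (ModuleCat.of R W) d ≃ₗ[R] ResidueField R)

namespace CanonicalSetup
variable {d : ℕ} {W : Type} [AddCommGroup W] [Module R W]

theorem ext_eq_zero (h : CanonicalSetup R d W) {Y : ModuleCat.{0} R} (hY : IsFID Y)
    (M : ModuleCat.{0} R) [Module.Finite R M] (hM : DepthGE d M) {i : ℕ} (hi : 0 < i) :
    Subsingleton (Ext M Y i) :=
  hY.ext_eq_zero_of_depthGE h.depth_ring h.ext_ring d M hM i (by omega)

theorem exists_comp_ne_zero (h : CanonicalSetup R d W) (N : ModuleCat.{0} R) [Module.Finite R N]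
    (hN : DepthGE d N) (ξ : Ext (resField R) N d)
    (hξ : ∀ f : N ⟶ ModuleCat.of R W, ξ.comp (Ext.mk₀ f) (add_zero d) = 0) : ξ = 0 := by
  by_contra hne
  obtain ⟨c, hc⟩ : ∃ c, c + 1 = d := ⟨d - 1, by have := h.pos; omega⟩
  obtain ⟨Z, _, θ, ha, hb, hcZ, hd⟩ := exists_syzygy_resField h.depth_ring c (by omega)
  obtain ⟨ξ', rfl⟩ := ha N 0 d hc ξ
  obtain ⟨n, π, hπ⟩ := Module.Finite.exists_fin' R Z
  have hex : Function.Exact (LinearMap.ker π).subtype π := LinearMap.exact_subtype_ker_map π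
  have hS := exactComplex_shortExact hex (Submodule.injective_subtype _) hπ
  have : Subsingleton (Ext (ModuleCat.of R (Fin n → R)) N 1) :=
    Ext.subsingleton_of_projective _ _ 0
  obtain ⟨φ', hφ⟩ := Ext.contravariant_sequence_exact₃ hS N ξ' (Subsingleton.elim _ _) (add_zero 1)
  obtain ⟨φ, rfl⟩ := Ext.homEquiv₀.symm.surjective φ'
  obtain ⟨E, _, f, g, hfg, hf, hg, hE⟩ := exists_extClass_eq hex (Submodule.injective_subtype _) hπ
    φ.hom
  have hξ' : ξ' = (exactComplex_shortExact hfg hf hg).extClass := hφ.symm.trans hE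
  subst hξ'
  have hES := exactComplex_shortExact hfg hf hg
  have hEd : DepthGE d E := by
    intro i hi
    by_cases hic : i < c
    · exact ext_mid_of_covariant hES _ i (hN i hi) (hcZ i hic)
    · obtain rfl : i = c := by omega
      refine subsingleton_of_forall_eq 0 fun e ↦ ?_
      obtain ⟨r, hr⟩ := hd (e.comp (Ext.mk₀ (ModuleCat.ofHom g)) (add_zero i))
      have h1 : r • θ.comp hES.extClass hc = 0 := by
        rw [← Ext.smul_comp]
        refine (congrArg (fun q ↦ Ext.comp q hES.extClass hc) hr.symm).trans ?_
        refine (Ext.comp_assoc_of_second_deg_zero e (Ext.mk₀ (ModuleCat.ofHom g)) hES.extClass hc).trans ?_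
        refine (congrArg (fun q ↦ e.comp q hc) (ShortComplex.ShortExact.comp_extClass hES)).trans ?_
        exact Ext.comp_zero e N 1 d hc
      have hrm : r ∈ maximalIdeal R := by
        by_contra hu
        have hu : IsUnit r := by simpa using hu
        obtain ⟨u, rfl⟩ := hu
        apply hne
        have := congrArg (fun q ↦ ((u⁻¹ : Rˣ) : R) • q) h1
        simpa [smul_smul] using this
      rw [smul_ext_resField hrm] at hr
      obtain ⟨y, rfl⟩ := Ext.covariant_sequence_exact₂ _ hES e hr
      have := hN i hi
      have hy : y = 0 := Subsingleton.elim (α := Ext (resField R) N i) y 0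
      rw [hy, Ext.zero_comp]
  have hEW : Subsingleton (Ext E (ModuleCat.of R W) 1) := h.ext_eq_zero h.fid E hEd one_pos
  have hZW : ∀ e : Ext Z (ModuleCat.of R W) 1, e = 0 := by
    intro e
    obtain ⟨y, hy⟩ := Ext.contravariant_sequence_exact₃ hES _ e (Subsingleton.elim _ _) (add_zero 1)
    obtain ⟨q, rfl⟩ := Ext.homEquiv₀.symm.surjective y
    rw [← hy]
    refine hb _ 0 d hc _ ?_
    exact (Ext.comp_assoc_of_third_deg_zero θ hES.extClass (Ext.mk₀ q) hc).symm.trans (hξ q)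
  obtain ⟨ε⟩ := h.simple
  have h1 := ε.symm.injective.ne (one_ne_zero (α := ResidueField R))
  rw [map_zero] at h1
  obtain ⟨y, hy⟩ := ha _ 0 d hc (ε.symm 1)
  rw [hZW y, Ext.comp_zero] at hy
  exact h1 hy.symm

end CanonicalSetup

end Syzygy

section Lifting
variable {R : Type} [CommRing R] {A B C : Type} [AddCommGroup A] [AddCommGroup B]
  [AddCommGroup C] [Module R A] [Module R B] [Module R C] {f : A →ₗ[R] B} {g : B →ₗ[R] C}

theorem exists_extension (hfg : Function.Exact f g) (hf : Function.Injective f)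
    (hg : Function.Surjective g) {Y : Type} [AddCommGroup Y] [Module R Y]
    (h : Subsingleton (Ext (ModuleCat.of R C) (ModuleCat.of R Y) 1)) (φ : A →ₗ[R] Y) :
    ∃ ψ : B →ₗ[R] Y, ψ ∘ₗ f = φ := by
  obtain ⟨e, he⟩ := Ext.contravariant_sequence_exact₁ (exactComplex_shortExact hfg hf hg)
    (ModuleCat.of R Y) (Ext.mk₀ (ModuleCat.ofHom φ)) (add_zero 1) (Subsingleton.elim _ _)
  obtain ⟨ψ, rfl⟩ := Ext.homEquiv₀.symm.surjective e
  refine ⟨ψ.hom, ?_⟩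
  change (Ext.mk₀ _).comp (Ext.mk₀ ψ) _ = _ at he
  rw [Ext.mk₀_comp_mk₀] at he
  have := Ext.homEquiv₀.symm.injective he
  exact congrArg ModuleCat.Hom.hom this

theorem exists_lift (hfg : Function.Exact f g) (hf : Function.Injective f)
    (hg : Function.Surjective g) {X : Type} [AddCommGroup X] [Module R X]
    (h : Subsingleton (Ext (ModuleCat.of R X) (ModuleCat.of R A) 1)) (φ : X →ₗ[R] C) :
    ∃ ψ : X →ₗ[R] B, g ∘ₗ ψ = φ := by
  obtain ⟨e, he⟩ := Ext.covariant_sequence_exact₃ (ModuleCat.of R X)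
    (exactComplex_shortExact hfg hf hg)
    (Ext.mk₀ (ModuleCat.ofHom φ)) (zero_add 1) (Subsingleton.elim _ _)
  obtain ⟨ψ, rfl⟩ := Ext.homEquiv₀.symm.surjective e
  refine ⟨ψ.hom, ?_⟩
  change (Ext.mk₀ ψ).comp (Ext.mk₀ _) _ = _ at he
  rw [Ext.mk₀_comp_mk₀] at he
  have := Ext.homEquiv₀.symm.injective he
  exact congrArg ModuleCat.Hom.hom this

theorem exact_mkQ (f : A →ₗ[R] B) : Function.Exact f (LinearMap.range f).mkQ := by
  rw [LinearMap.exact_iff, Submodule.ker_mkQ]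

theorem sum_single_proj (m : ℕ) : (LinearMap.id : (Fin m → A) →ₗ[R] (Fin m → A)) =
    ∑ j, LinearMap.single R (fun _ : Fin m ↦ A) j ∘ₗ
      LinearMap.proj (R := R) (φ := fun _ : Fin m ↦ A) j := by
  ext x i
  simp [Finset.sum_apply, Pi.single_apply]

end Lifting

section TopExt
open IsLocalRing
variable {R : Type} [CommRing R] [IsLocalRing R]
variable {A B C : Type} [AddCommGroup A] [AddCommGroup B]
  [AddCommGroup C] [Module R A] [Module R B] [Module R C]

variable (R A) in
/-- The module `Ext^d(k, A)`. -/
abbrev TopExt (d : ℕ) : Type := Ext (resField R) (ModuleCat.of R A) d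

/-- The map `Ext^d(k, A) → Ext^d(k, B)` induced by a linear map. -/
def topMap (d : ℕ) (f : A →ₗ[R] B) : TopExt R A d →ₗ[R] TopExt R B d where
  toFun e := e.comp (Ext.mk₀ (ModuleCat.ofHom f)) (add_zero d)
  map_add' _ _ := Ext.add_comp _ _ _ _
  map_smul' _ _ := Ext.smul_comp _ _ _ _

theorem topMap_comp (d : ℕ) (g : B →ₗ[R] C) (f : A →ₗ[R] B) (e : TopExt R A d) :
    topMap d (g ∘ₗ f) e = topMap d g (topMap d f e) := by
  change e.comp (Ext.mk₀ (ModuleCat.ofHom (g ∘ₗ f))) (add_zero d) =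
    (e.comp (Ext.mk₀ (ModuleCat.ofHom f)) (add_zero d)).comp (Ext.mk₀ (ModuleCat.ofHom g)) (add_zero d)
  rw [Ext.comp_assoc_of_second_deg_zero, Ext.mk₀_comp_mk₀]
  rfl

theorem topMap_id (d : ℕ) (e : TopExt R A d) : topMap d LinearMap.id e = e :=
  Ext.comp_mk₀_id e

theorem topMap_add (d : ℕ) (f g : A →ₗ[R] B) (e : TopExt R A d) :
    topMap d (f + g) e = topMap d f e + topMap d g e := by
  change e.comp (Ext.mk₀ (ModuleCat.ofHom f + ModuleCat.ofHom g)) (add_zero d) = _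
  rw [Ext.mk₀_add, Ext.comp_add]
  rfl

theorem topMap_sum (d m : ℕ) (f : Fin m → (A →ₗ[R] B)) (e : TopExt R A d) :
    topMap d (∑ j, f j) e = ∑ j, topMap d (f j) e := by
  change e.comp (Ext.mk₀ (ModuleCat.ofHom (∑ j, f j))) (add_zero d) = _
  have : ModuleCat.ofHom (∑ j, f j) = ∑ j, ModuleCat.ofHom (f j) := by
    ext x; simp [ModuleCat.hom_sum]
  rw [this, Ext.mk₀_sum, Ext.comp_sum]
  rfl

theorem topMap_zero (d : ℕ) (e : TopExt R A d) : topMap d (0 : A →ₗ[R] B) e = 0 := by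
  change e.comp (Ext.mk₀ 0) (add_zero d) = _
  rw [Ext.mk₀_zero, Ext.comp_zero]

theorem topMap_eq_zero_of_components {m : ℕ} (f : (Fin m → A) →ₗ[R] B)
    (hf : ∀ j, ∀ e : TopExt R A d,
      topMap d (f ∘ₗ LinearMap.single R (fun _ : Fin m ↦ A) j) e = 0)
    (e : TopExt R (Fin m → A) d) : topMap d f e = 0 := by
  have : f = f ∘ₗ LinearMap.id := rfl
  rw [this, topMap_comp, sum_single_proj, topMap_sum, map_sum]
  refine Finset.sum_eq_zero fun j _ ↦ ?_
  rw [← topMap_comp, ← LinearMap.comp_assoc, topMap_comp, hf]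

variable (R) in
/-- Finitely generated modules which are zero or of depth at least `d`. -/
structure HasDepth (d : ℕ) (A : Type) [AddCommGroup A] [Module R A] : Prop where
  finite : Module.Finite R A
  depth : DepthGE d (ModuleCat.of R A)

theorem HasDepth.pi {d : ℕ} (h : HasDepth R d A) (m : ℕ) : HasDepth R d (Fin m → A) :=
  have := h.finite
  ⟨inferInstance, h.depth.pi m⟩

theorem HasDepth.of_retract {d : ℕ} (h : HasDepth R d A) (i : B →ₗ[R] A) (p : A →ₗ[R] B)
    (hpi : p ∘ₗ i = LinearMap.id) : HasDepth R d B :=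
  have := h.finite
  ⟨Module.Finite.of_surjective p fun b ↦ ⟨i b, LinearMap.congr_fun hpi b⟩,
    h.depth.of_retract (ModuleCat.ofHom i) (ModuleCat.ofHom p) (by
      rw [← ModuleCat.ofHom_comp, hpi]; rfl)⟩

theorem HasDepth.of_exact {d : ℕ} [IsNoetherianRing R] {f : A →ₗ[R] B} {g : B →ₗ[R] C}
    (hfg : Function.Exact f g) (hf : Function.Injective f) (hg : Function.Surjective g)
    (hA : HasDepth R d A) (hC : HasDepth R d C) : HasDepth R d B := by
  have := hA.finite
  have := hC.finite
  refine ⟨Module.Finite.of_exact hfg hg, fun i hi ↦ ?_⟩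
  exact ext_mid_of_covariant (exactComplex_shortExact hfg hf hg) _ i (hA.depth i hi) (hC.depth i hi)

theorem HasDepth.prod {d : ℕ} [IsNoetherianRing R] (hA : HasDepth R d A) (hB : HasDepth R d B) : HasDepth R d (A × B) :=
  HasDepth.of_exact (f := LinearMap.inl R A B) (g := LinearMap.snd R A B)
    Function.Exact.inl_snd LinearMap.inl_injective LinearMap.snd_surjective hA hB

end TopExt

section InjDim
variable {R : Type} [CommRing R] {A B : Type} [AddCommGroup A] [AddCommGroup B] [Module R A]
  [Module R B]

variable (R) in
/-- Finite injective dimension of a finitely generated module, unbundled. -/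
abbrev FID (Y : Type) [AddCommGroup Y] [Module R Y] : Prop := IsFID (ModuleCat.of R Y)

theorem FID.pi (h : FID R A) (m : ℕ) : FID R (Fin m → A) := by
  have : Module.Finite R A := h.finite
  obtain ⟨n, hn⟩ := h.vanish
  exact ⟨inferInstanceAs (Module.Finite R (Fin m → A)),
    n, fun N i hi ↦ subsingleton_ext_pi m (hn N i hi)⟩

theorem FID.of_retract (h : FID R A) (i : B →ₗ[R] A) (p : A →ₗ[R] B)
    (hpi : p ∘ₗ i = LinearMap.id) : FID R B := by
  have : Module.Finite R A := h.finite
  obtain ⟨n, hn⟩ := h.vanish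
  exact ⟨Module.Finite.of_surjective p fun b ↦ ⟨i b, LinearMap.congr_fun hpi b⟩, n,
    fun N j hj ↦ subsingleton_ext_of_retract (ModuleCat.ofHom i) (ModuleCat.ofHom p) (by
      rw [← ModuleCat.ofHom_comp, hpi]; rfl) (hn N j hj)⟩

end InjDim

section Canonical
open IsLocalRing
variable {R : Type} [CommRing R] [IsLocalRing R]
variable {A B C : Type} [AddCommGroup A] [AddCommGroup B]
  [AddCommGroup C] [Module R A] [Module R B] [Module R C]

namespace CanonicalSetup
variable {d : ℕ} {W : Type} [AddCommGroup W] [Module R W]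

theorem hasDepth (h : CanonicalSetup R d W) : HasDepth R d W := ⟨h.fid.finite, h.depth⟩

theorem nontrivial_topExt (h : CanonicalSetup R d W) : Nontrivial (TopExt R W d) := by
  obtain ⟨ε⟩ := h.simple
  exact ε.toEquiv.nontrivial

theorem exists_smul_eq (h : CanonicalSetup R d W) {e : TopExt R W d} (he : e ≠ 0) (e' : TopExt R W d) :
    ∃ r : R, e' = r • e := by
  obtain ⟨ε⟩ := h.simple
  have h0 : ε e ≠ 0 := fun h0 ↦ he (ε.injective (h0.trans (map_zero _).symm))
  obtain ⟨r, hr⟩ := residue_surjective (ε e' / ε e)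
  refine ⟨r, ε.injective ?_⟩
  rw [map_smul, Algebra.smul_def]
  change _ = residue R r * _
  rw [hr, div_mul_cancel₀ _ h0]

variable [IsNoetherianRing R]

theorem ext_one (h : CanonicalSetup R d W) (hA : HasDepth R d A) (hB : FID R B) :
    Subsingleton (Ext (ModuleCat.of R A) (ModuleCat.of R B) 1) :=
  have : Module.Finite R (ModuleCat.of R A) := hA.finite
  h.ext_eq_zero hB _ hA.depth one_pos

theorem ext_resField_succ (h : CanonicalSetup R d W) (hB : FID R B) :
    Subsingleton (Ext (resField R) (ModuleCat.of R B) (d + 1)) :=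
  IsFID.ext_eq_zero h.depth_ring h.ext_ring hB (resField R) (Nat.lt_succ_self d)

theorem injective_of_topMap (h : CanonicalSetup R d W) (hA : HasDepth R d A) (hB : HasDepth R d B) (f : A →ₗ[R] B)
    (hf : Function.Injective (topMap d f)) : Function.Injective f := by
  have : Module.Finite R (ModuleCat.of R A) := hA.finite
  have : Module.Finite R (ModuleCat.of R B) := hB.finite
  refine injective_of_ext_injective d (ModuleCat.of R A) (ModuleCat.of R B) (ModuleCat.ofHom f)
    hA.depth hB.depth ?_ fun e he ↦ hf (he.trans (map_zero _).symm)
  rw [← h.dim]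
  exact Module.supportDim_le_ringKrullDim R A

theorem hasDepth_quotient_range (h : CanonicalSetup R d W) (hA : HasDepth R d A) (hB : HasDepth R d B) (f : A →ₗ[R] B)
    (hf : Function.Injective (topMap d f)) : HasDepth R d (B ⧸ LinearMap.range f) := by
  have := hB.finite
  have hfi := h.injective_of_topMap hA hB f hf
  have hS := exactComplex_shortExact (exact_mkQ f) hfi (Submodule.mkQ_surjective _)
  refine ⟨inferInstance, fun i hi ↦ ?_⟩
  by_cases hid : i + 1 < d
  · exact ext_right_of_covariant hS _ i (hB.depth i hi) (hA.depth (i + 1) hid)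
  · obtain rfl : i + 1 = d := by omega
    refine subsingleton_of_forall_eq 0 fun e ↦ ?_
    have h0 : e.comp hS.extClass rfl = 0 := by
      apply hf
      rw [map_zero]
      refine (Ext.comp_assoc_of_third_deg_zero e hS.extClass (Ext.mk₀ (ModuleCat.ofHom f)) rfl).trans ?_
      refine (congrArg (fun q ↦ e.comp q rfl) (ShortComplex.ShortExact.extClass_comp hS)).trans ?_
      exact Ext.comp_zero e _ _ _ _
    obtain ⟨y, rfl⟩ := Ext.covariant_sequence_exact₃ _ hS e rfl h0
    have := hB.depth i hi
    have hy : y = 0 := Subsingleton.elim (α := Ext (resField R) (ModuleCat.of R B) i) y 0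
    rw [hy, Ext.zero_comp]

theorem subsingleton_of_topExt (h : CanonicalSetup R d W) (hA : HasDepth R d A) (hT : Subsingleton (TopExt R A d)) :
    Subsingleton A := by
  have hinj := h.injective_of_topMap (B := PUnit) hA
    ⟨inferInstance, fun i _ ↦ subsingleton_ext_of_subsingleton_right i inferInstance⟩ 0
    (fun _ _ _ ↦ Subsingleton.elim _ _)
  exact hinj.subsingleton

theorem bijective_of_topMap (h : CanonicalSetup R d W) (hA : HasDepth R d A) (hB : HasDepth R d B)
    (hA' : Subsingleton (Ext (resField R) (ModuleCat.of R A) (d + 1))) (f : A →ₗ[R] B)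
    (hf : Function.Bijective (topMap d f)) : Function.Bijective f := by
  have hfi := h.injective_of_topMap hA hB f hf.1
  have hS := exactComplex_shortExact (exact_mkQ f) hfi (Submodule.mkQ_surjective _)
  have := h.subsingleton_of_topExt (h.hasDepth_quotient_range hA hB f hf.1)
    (subsingleton_of_forall_eq 0 fun e ↦ by
      obtain ⟨y, rfl⟩ := Ext.covariant_sequence_exact₃ _ hS e rfl (Subsingleton.elim _ _)
      obtain ⟨z, rfl⟩ := hf.2 y
      refine (Ext.comp_assoc_of_second_deg_zero z (Ext.mk₀ (ModuleCat.ofHom f))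
        (Ext.mk₀ (ModuleCat.ofHom (LinearMap.range f).mkQ)) (add_zero d)).trans ?_
      rw [Ext.mk₀_comp_mk₀, ← ModuleCat.ofHom_comp, (exact_mkQ f).linearMap_comp_eq_zero]
      exact topMap_zero d z)
  refine ⟨hfi, ?_⟩
  rw [← LinearMap.range_eq_top]
  exact Submodule.Quotient.subsingleton_iff.1 this

theorem bijective_topMap_of_ne_zero (h : CanonicalSetup R d W) (f : W →ₗ[R] W) {e₀ : TopExt R W d} (he : topMap d f e₀ ≠ 0) :
    Function.Bijective (topMap d f) := by
  have he₀ : e₀ ≠ 0 := fun h0 ↦ he (by rw [h0, map_zero])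
  constructor
  · rw [injective_iff_map_eq_zero]
    intro e h0
    by_contra hne
    obtain ⟨r, rfl⟩ := h.exists_smul_eq hne e₀
    rw [map_smul, h0, smul_zero] at he
    exact he rfl
  · intro e
    obtain ⟨r, rfl⟩ := h.exists_smul_eq he e
    exact ⟨r • e₀, map_smul _ _ _⟩

theorem bijective_of_topMap_ne_zero (h : CanonicalSetup R d W) (f : W →ₗ[R] W) {e₀ : TopExt R W d}
    (he : topMap d f e₀ ≠ 0) : Function.Bijective f :=
  h.bijective_of_topMap h.hasDepth h.hasDepth (h.ext_resField_succ h.fid) f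
    (h.bijective_topMap_of_ne_zero f he)

theorem exists_embedding (h : CanonicalSetup R d W) (hA : HasDepth R d A) : ∃ (m : ℕ) (u : A →ₗ[R] (Fin m → W)),
    Function.Injective u ∧ HasDepth R d ((Fin m → W) ⧸ LinearMap.range u) := by
  have : Module.Finite R (ModuleCat.of R A) := hA.finite
  have : Module.Finite R (ModuleCat.of R W) := h.fid.finite
  have hfin : Module.Finite R (Ext (ModuleCat.of R A) (ModuleCat.of R W) 0) := inferInstance
  obtain ⟨m, s, hs⟩ := Module.Finite.exists_fin (R := R)
    (M := Ext (ModuleCat.of R A) (ModuleCat.of R W) 0)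
  let f : Fin m → (A →ₗ[R] W) := fun i ↦ (Ext.homEquiv₀ (s i)).hom
  have hf : ∀ i, Ext.mk₀ (ModuleCat.ofHom (f i)) = s i := fun i ↦
    Ext.homEquiv₀.symm_apply_apply (s i)
  let u : A →ₗ[R] (Fin m → W) := LinearMap.pi f
  have hu : Function.Injective (topMap d u) := by
    rw [injective_iff_map_eq_zero]
    intro ξ hξ
    have h1 : ∀ i, ξ.comp (s i) (add_zero d) = 0 := by
      intro i
      rw [← hf]
      change topMap d (f i) ξ = 0
      have : f i = LinearMap.proj i ∘ₗ u := rfl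
      rw [this, topMap_comp, hξ, map_zero]
    refine h.exists_comp_ne_zero (ModuleCat.of R A) hA.depth ξ fun g ↦ ?_
    suffices ∀ x ∈ Submodule.span R (Set.range s), ξ.comp x (add_zero d) = 0 from
      this _ (by rw [hs]; trivial)
    intro x hg
    induction hg using Submodule.span_induction with
    | mem x hx => obtain ⟨i, rfl⟩ := hx; exact h1 i
    | zero => exact Ext.comp_zero _ _ _ _ _
    | add x y _ _ hx hy => rw [Ext.comp_add, hx, hy, add_zero]
    | smul a x _ hx => rw [Ext.comp_smul, hx, smul_zero]
  exact ⟨m, u, h.injective_of_topMap hA (h.hasDepth.pi m) u hu,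
    h.hasDepth_quotient_range hA (h.hasDepth.pi m) u hu⟩

theorem exists_factor (h : CanonicalSetup R d W) (hA : HasDepth R d A) (hB : FID R B) (f : A →ₗ[R] B) :
    ∃ (m : ℕ) (u : A →ₗ[R] (Fin m → W)) (v : (Fin m → W) →ₗ[R] B), v ∘ₗ u = f := by
  obtain ⟨m, u, hu, hC⟩ := h.exists_embedding hA
  obtain ⟨v, hv⟩ := exists_extension (exact_mkQ u) hu (Submodule.mkQ_surjective _)
    (h.ext_one hC hB) f
  exact ⟨m, u, v, hv⟩

theorem bijective_id_add_comp (h : CanonicalSetup R d W) (hX : HasDepth R d A) (hY : FID R B) (φ : B →ₗ[R] A)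
    (hφ : ¬ ∃ (s : W →ₗ[R] B) (p : A →ₗ[R] W), Function.Bijective (p ∘ₗ φ ∘ₗ s))
    (q : A →ₗ[R] B) : Function.Bijective ((LinearMap.id : A →ₗ[R] A) + φ ∘ₗ q) := by
  obtain ⟨m, u, v, rfl⟩ := h.exists_factor hX hY q
  have hT : ∀ e, topMap d (u ∘ₗ φ ∘ₗ v) e = 0 := by
    intro e
    refine ext_pi_eq_zero _ fun i ↦ ?_
    change topMap d (LinearMap.proj (R := R) (φ := fun _ : Fin m ↦ W) i) _ = 0
    rw [← topMap_comp]
    refine topMap_eq_zero_of_components _ (fun j e ↦ ?_) e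
    by_contra hne
    exact hφ ⟨v ∘ₗ LinearMap.single R (fun _ : Fin m ↦ W) j,
      LinearMap.proj (R := R) (φ := fun _ : Fin m ↦ W) i ∘ₗ u,
      h.bijective_of_topMap_ne_zero _ hne⟩
  have hid : ∀ e, topMap d ((LinearMap.id : (Fin m → W) →ₗ[R] (Fin m → W)) + u ∘ₗ φ ∘ₗ v) e = e := fun e ↦ by
    rw [topMap_add, topMap_id, hT, add_zero]
  have hbij := h.bijective_of_topMap (h.hasDepth.pi m) (h.hasDepth.pi m)
    (h.ext_resField_succ (FID.pi h.fid m))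
    ((LinearMap.id : (Fin m → W) →ₗ[R] (Fin m → W)) + u ∘ₗ φ ∘ₗ v)
    ⟨fun a b hab ↦ by rwa [hid, hid] at hab, fun e ↦ ⟨e, hid e⟩⟩
  constructor
  · rw [injective_iff_map_eq_zero]
    intro x hx
    have hx' : x + φ (v (u x)) = 0 := hx
    have h1 : u x = 0 := hbij.1 (by
      change u x + u (φ (v (u x))) = _
      rw [← map_add, hx', map_zero, map_zero])
    rwa [h1, map_zero, map_zero, add_zero] at hx'
  · intro y
    obtain ⟨w, hw⟩ := hbij.2 (u y)
    have hw' : w + u (φ (v w)) = u y := hw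
    refine ⟨y - φ (v w), ?_⟩
    change y - φ (v w) + φ (v (u (y - φ (v w)))) = y
    rw [map_sub u, ← hw', add_sub_cancel_right, sub_add_cancel]

end CanonicalSetup
end Canonical

section Splitting
variable {R : Type} [CommRing R]
variable {A B C : Type} [AddCommGroup A] [AddCommGroup B]
  [AddCommGroup C] [Module R A] [Module R B] [Module R C]

/-- A split surjection identifies its source with the product of its target and its kernel. -/
def splitEquiv (p : A →ₗ[R] B) (s : B →ₗ[R] A) (hps : ∀ b, p (s b) = b) :
    A ≃ₗ[R] B × LinearMap.ker p where
  toFun a := (p a, ⟨a - s (p a), by rw [LinearMap.mem_ker, map_sub, hps, sub_self]⟩)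
  map_add' a b := by
    ext
    · exact map_add p a b
    · change a + b - s (p (a + b)) = (a - s (p a)) + (b - s (p b))
      rw [map_add, map_add]; abel
  map_smul' r a := by
    ext
    · exact map_smul p r a
    · change r • a - s (p (r • a)) = r • (a - s (p a))
      rw [map_smul, map_smul, smul_sub]
  invFun z := s z.1 + z.2
  left_inv a := by
    change s (p a) + (a - s (p a)) = a
    abel
  right_inv z := by
    have hz : p z.2 = 0 := z.2.2
    ext
    · change p (s z.1 + z.2) = z.1
      rw [map_add, hps, hz, add_zero]
    · change s z.1 + z.2 - s (p (s z.1 + z.2)) = z.2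
      rw [map_add, hps, hz, add_zero, add_sub_cancel_left]

theorem exists_section_of_bijective {W : Type} [AddCommGroup W] [Module R W] (s : W →ₗ[R] A)
    (p : A →ₗ[R] W) (h : Function.Bijective (p ∘ₗ s)) :
    ∃ ε : W →ₗ[R] W, ∀ w, p (s (ε w)) = w := by
  let ε := LinearEquiv.ofBijective _ h
  exact ⟨ε.symm, fun w ↦ ε.apply_symm_apply w⟩

theorem hasCommonSummandVia_of_bijective {Y X : ModuleCat.{0} R} (φ : Y →ₗ[R] X) {W : Type}
    [AddCommGroup W] [Module R W] [Nontrivial W] (s : W →ₗ[R] Y) (p : X →ₗ[R] W)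
    (h : Function.Bijective (p ∘ₗ φ ∘ₗ s)) : HasCommonSummandVia R φ := by
  obtain ⟨ε, hε⟩ := exists_section_of_bijective s (p ∘ₗ φ) h
  refine ⟨ModuleCat.of R W, ModuleCat.of R (LinearMap.ker (p ∘ₗ φ)),
    ModuleCat.of R (LinearMap.ker p), inferInstanceAs (Nontrivial W),
    splitEquiv (p ∘ₗ φ) (s ∘ₗ ε) hε, splitEquiv p (φ ∘ₗ s ∘ₗ ε) hε,
    (φ ∘ₗ (LinearMap.ker (p ∘ₗ φ)).subtype).codRestrict (LinearMap.ker p) fun y ↦ y.2,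
    fun y ↦ ?_⟩
  refine Prod.ext rfl (Subtype.ext ?_)
  change φ y - φ (s (ε (p (φ y)))) = φ (y - s (ε (p (φ y))))
  rw [map_sub]

theorem exists_desc {f : A →ₗ[R] B} {g : B →ₗ[R] C} (hfg : Function.Exact f g)
    (hg : Function.Surjective g) {D : Type} [AddCommGroup D] [Module R D] (φ : B →ₗ[R] D)
    (hφ : ∀ a, φ (f a) = 0) : ∃ ψ : C →ₗ[R] D, ∀ b, ψ (g b) = φ b := by
  have hk : LinearMap.ker g ≤ LinearMap.ker φ := fun b hb ↦ by
    obtain ⟨a, rfl⟩ := (hfg b).1 hb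
    exact hφ a
  refine ⟨(LinearMap.ker g).liftQ φ hk ∘ₗ (g.quotKerEquivOfSurjective hg).symm, fun b ↦ ?_⟩
  have : (g.quotKerEquivOfSurjective hg).symm (g b) = (LinearMap.ker g).mkQ b := by
    rw [LinearEquiv.symm_apply_eq]
    rfl
  change (LinearMap.ker g).liftQ φ hk ((g.quotKerEquivOfSurjective hg).symm (g b)) = _
  rw [this]
  rfl

theorem exists_corestrict {f : A →ₗ[R] B} {g : B →ₗ[R] C} (hfg : Function.Exact f g)
    (hf : Function.Injective f) {D : Type} [AddCommGroup D] [Module R D] (φ : D →ₗ[R] B)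
    (hφ : ∀ x, g (φ x) = 0) : ∃ ψ : D →ₗ[R] A, ∀ x, f (ψ x) = φ x := by
  let ε := LinearEquiv.ofInjective f hf
  refine ⟨ε.symm ∘ₗ φ.codRestrict (LinearMap.range f) fun x ↦ (hfg _).1 (hφ x), fun x ↦ ?_⟩
  exact congrArg Subtype.val (ε.apply_symm_apply _)

theorem nonempty_linearEquiv_of_prod {W : Type} [AddCommGroup W] [Module R W]
    (ψ : (W × A) ≃ₗ[R] (W × B))
    (h : Function.Bijective (LinearMap.fst R W B ∘ₗ ψ.toLinearMap ∘ₗ LinearMap.inl R W A)) :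
    Nonempty (A ≃ₗ[R] B) := by
  let a := LinearEquiv.ofBijective _ h
  have ha : ∀ w, a w = (ψ (w, 0)).1 := fun _ ↦ rfl
  have hsum : ∀ w z, ψ (w, z) = ψ (w, 0) + ψ (0, z) := fun w z ↦ by
    rw [← map_add, Prod.mk_add_mk, add_zero, zero_add]
  let b : A →ₗ[R] W := LinearMap.fst R W B ∘ₗ ψ.toLinearMap ∘ₗ LinearMap.inr R W A
  have hb : ∀ z, b z = (ψ (0, z)).1 := fun _ ↦ rfl
  let l : A →ₗ[R] (W × A) := (-(a.symm.toLinearMap ∘ₗ b)).prod LinearMap.id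
  have hl : ∀ z, l z = (-(a.symm (b z)), z) := fun _ ↦ rfl
  have h1 : ∀ z, (ψ (l z)).1 = 0 := fun z ↦ by
    rw [hl, hsum, Prod.fst_add, ← ha, ← hb, map_neg, a.apply_symm_apply, neg_add_cancel]
  refine ⟨LinearEquiv.ofBijective (LinearMap.snd R W B ∘ₗ ψ.toLinearMap ∘ₗ l) ⟨?_, ?_⟩⟩
  · rw [injective_iff_map_eq_zero]
    intro z hz
    have : ψ (l z) = 0 := Prod.ext (h1 z) hz
    exact congrArg Prod.snd ((map_eq_zero_iff ψ ψ.injective).1 this)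
  · intro y
    obtain ⟨⟨w, z⟩, hz⟩ := ψ.surjective (0, y)
    refine ⟨z, ?_⟩
    have : l z = (w, z) := by
      rw [hl]
      congr 1
      rw [neg_eq_iff_eq_neg, LinearEquiv.symm_apply_eq, map_neg, ha, hb,
        ← add_eq_zero_iff_eq_neg, add_comm, ← Prod.fst_add, ← hsum, hz]
    change (ψ (l z)).2 = y
    rw [this, hz]

theorem FID.of_exact_left {f : A →ₗ[R] B} {g : B →ₗ[R] C} [IsNoetherianRing R]
    (hfg : Function.Exact f g) (hf : Function.Injective f) (hg : Function.Surjective g)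
    (hB : FID R B) (hC : FID R C) : FID R A := by
  have : Module.Finite R B := hB.finite
  obtain ⟨n, hn⟩ := hB.vanish
  obtain ⟨m, hm⟩ := hC.vanish
  refine ⟨Module.Finite.of_injective f hf, n + m + 1, fun N i hi ↦ ?_⟩
  obtain ⟨i, rfl⟩ : ∃ j, i = j + 1 := ⟨i - 1, by omega⟩
  exact ext_left_of_covariant (exactComplex_shortExact hfg hf hg) N i (hm N i (by omega))
    (hn N (i + 1) (by omega))

theorem FID.of_exact_right {f : A →ₗ[R] B} {g : B →ₗ[R] C}
    (hfg : Function.Exact f g) (hf : Function.Injective f) (hg : Function.Surjective g)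
    (hA : FID R A) (hB : FID R B) : FID R C := by
  have : Module.Finite R B := hB.finite
  obtain ⟨n, hn⟩ := hA.vanish
  obtain ⟨m, hm⟩ := hB.vanish
  refine ⟨Module.Finite.of_surjective g hg, n + m, fun N i hi ↦ ?_⟩
  exact ext_right_of_covariant (exactComplex_shortExact hfg hf hg) N i (hm N i (by omega))
    (hn N (i + 1) (by omega))

variable (R) in
/-- `W` is a direct summand of both modules via the map. -/
def SummandVia (W : Type) [AddCommGroup W] [Module R W] (φ : A →ₗ[R] B) : Prop :=
  ∃ (s : W →ₗ[R] A) (p : B →ₗ[R] W), Function.Bijective (p ∘ₗ φ ∘ₗ s)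

theorem SummandVia.target {A B W : Type} [AddCommGroup A] [AddCommGroup B] [AddCommGroup W]
    [Module R A] [Module R B] [Module R W] {φ : A →ₗ[R] B} (h : SummandVia R W φ) :
    SummandVia R W (LinearMap.id : B →ₗ[R] B) := by
  obtain ⟨s, p, hps⟩ := h
  exact ⟨φ ∘ₗ s, p, hps⟩

theorem not_summandVia_of_minimal {Y X : ModuleCat.{0} R} {φ : Y →ₗ[R] X} {W : Type}
    [AddCommGroup W] [Module R W] [Nontrivial W] (h : ¬ HasCommonSummandVia R φ) :
    ¬ SummandVia R W φ := fun ⟨s, p, hps⟩ ↦ h (hasCommonSummandVia_of_bijective φ s p hps)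

end Splitting

section Canonical
open IsLocalRing
variable {R : Type} [CommRing R] [IsLocalRing R] [IsNoetherianRing R]
variable {A B C : Type} [AddCommGroup A] [AddCommGroup B]
  [AddCommGroup C] [Module R A] [Module R B] [Module R C]

namespace CanonicalSetup
variable {d : ℕ} {W : Type} [AddCommGroup W] [Module R W]

theorem summandVia_of_topMap_ne_zero (h : CanonicalSetup R d W) {m : ℕ} (v : (Fin m → W) →ₗ[R] A) (φ : A →ₗ[R] B)
    (p : B →ₗ[R] W) {e : TopExt R (Fin m → W) d} (he : topMap d (p ∘ₗ φ ∘ₗ v) e ≠ 0) :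
    SummandVia R W φ := by
  by_contra hn
  refine he (topMap_eq_zero_of_components _ (fun j e' ↦ ?_) e)
  by_contra hne
  exact hn ⟨v ∘ₗ LinearMap.single R (fun _ : Fin m ↦ W) j, p,
    h.bijective_of_topMap_ne_zero _ hne⟩

theorem not_summand_of_minimal (h : CanonicalSetup R d W) {f : A →ₗ[R] B} {g : B →ₗ[R] C}
    (hfg : Function.Exact f g) (hf : Function.Injective f) (hg : Function.Surjective g)
    (hA : HasDepth R d A) (hC : HasDepth R d C) (hB : FID R B) (hmin : ¬ SummandVia R W g) :
    ¬ SummandVia R W (LinearMap.id : C →ₗ[R] C) := by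
  rintro ⟨s, p, hps⟩
  have hq : Function.Surjective (p ∘ₗ g) := by
    rw [LinearMap.coe_comp]
    refine Function.Surjective.comp (fun w ↦ ?_) hg
    obtain ⟨w', hw'⟩ := hps.2 w
    exact ⟨s w', hw'⟩
  have hK := FID.of_exact_left (LinearMap.exact_subtype_ker_map (p ∘ₗ g))
    (Submodule.injective_subtype _) hq hB h.fid
  obtain ⟨m, u, v, huv⟩ := h.exists_factor (HasDepth.of_exact hfg hf hg hA hC) hB LinearMap.id
  obtain ⟨e, he⟩ := @exists_ne _ h.nontrivial_topExt 0
  have := h.ext_resField_succ hK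
  obtain ⟨y, hy⟩ := Ext.covariant_sequence_exact₃ (resField R)
    (exactComplex_shortExact (LinearMap.exact_subtype_ker_map (p ∘ₗ g))
      (Submodule.injective_subtype _) hq) e rfl (Subsingleton.elim _ _)
  refine hmin (h.summandVia_of_topMap_ne_zero v g p (e := topMap d u y) ?_)
  rw [← LinearMap.comp_assoc, topMap_comp, ← topMap_comp d v u, huv, topMap_id]
  exact fun h0 ↦ he (hy.symm.trans h0)

theorem summand_of_retract (h : CanonicalSetup R d W) {m : ℕ} (hA : HasDepth R d A) [Nontrivial A]
    (u : A →ₗ[R] (Fin m → W)) (v : (Fin m → W) →ₗ[R] A) (hvu : v ∘ₗ u = LinearMap.id) :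
    SummandVia R W (LinearMap.id : A →ₗ[R] A) := by
  have hT : Nontrivial (TopExt R A d) := by
    by_contra hT
    exact not_subsingleton A (h.subsingleton_of_topExt hA (not_nontrivial_iff_subsingleton.1 hT))
  obtain ⟨e, he⟩ := exists_ne (0 : TopExt R A d)
  have hve : topMap d v (topMap d u e) = e := by rw [← topMap_comp, hvu, topMap_id]
  obtain ⟨i, hi⟩ : ∃ i, topMap d (LinearMap.proj (R := R) (φ := fun _ : Fin m ↦ W) i)
      (topMap d u e) ≠ 0 := by
    by_contra! hi
    exact he (by rw [← hve, ext_pi_eq_zero (topMap d u e) hi, map_zero])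
  refine h.summandVia_of_topMap_ne_zero v LinearMap.id
    (LinearMap.proj (R := R) (φ := fun _ : Fin m ↦ W) i ∘ₗ u) (e := topMap d u e) ?_
  rw [LinearMap.id_comp, topMap_comp, hve, topMap_comp]
  exact hi

theorem nonempty_linearEquiv_of_hulls (h : CanonicalSetup R d W) {M Y X Y' X' : Type} [AddCommGroup M] [AddCommGroup Y]
    [AddCommGroup X] [AddCommGroup Y'] [AddCommGroup X'] [Module R M] [Module R Y] [Module R X]
    [Module R Y'] [Module R X'] {ι : M →ₗ[R] Y} {π : Y →ₗ[R] X} {ι' : M →ₗ[R] Y'}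
    {π' : Y' →ₗ[R] X'} (he : Function.Exact ι π) (hι : Function.Injective ι)
    (hπ : Function.Surjective π) (he' : Function.Exact ι' π') (hι' : Function.Injective ι')
    (hπ' : Function.Surjective π') (hY : FID R Y) (hX : HasDepth R d X) (hY' : FID R Y')
    (hX' : HasDepth R d X') (hmin : ¬ SummandVia R W π) (hmin' : ¬ SummandVia R W π') :
    Nonempty (X ≃ₗ[R] X') := by
  obtain ⟨β, hβ⟩ := exists_extension he hι hπ (h.ext_one hX hY') ι'
  obtain ⟨β', hβ'⟩ := exists_extension he' hι' hπ' (h.ext_one hX' hY) ι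
  replace hβ := LinearMap.congr_fun hβ
  replace hβ' := LinearMap.congr_fun hβ'
  simp only [LinearMap.comp_apply] at hβ hβ'
  obtain ⟨b, hb⟩ := exists_desc he hπ (π' ∘ₗ β) fun a ↦ by
    rw [LinearMap.comp_apply, hβ, he'.apply_apply_eq_zero]
  obtain ⟨b', hb'⟩ := exists_desc he' hπ' (π ∘ₗ β') fun a ↦ by
    rw [LinearMap.comp_apply, hβ', he.apply_apply_eq_zero]
  obtain ⟨q, hq⟩ := exists_desc he hπ (β' ∘ₗ β - LinearMap.id) fun a ↦ by
    rw [LinearMap.sub_apply, LinearMap.comp_apply, hβ, hβ', LinearMap.id_apply, sub_self]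
  obtain ⟨q', hq'⟩ := exists_desc he' hπ' (β ∘ₗ β' - LinearMap.id) fun a ↦ by
    rw [LinearMap.sub_apply, LinearMap.comp_apply, hβ', hβ, LinearMap.id_apply, sub_self]
  have h1 : ∀ z, b' (b z) = z + π (q z) := fun z ↦ by
    obtain ⟨y, rfl⟩ := hπ z
    rw [hb, LinearMap.comp_apply, hb', hq, ← map_add]
    exact congrArg π (add_sub_cancel y (β' (β y))).symm
  have h2 : ∀ z, b (b' z) = z + π' (q' z) := fun z ↦ by
    obtain ⟨y, rfl⟩ := hπ' z
    rw [hb', LinearMap.comp_apply, hb, hq', ← map_add]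
    exact congrArg π' (add_sub_cancel y (β (β' y))).symm
  have H1 := h.bijective_id_add_comp hX hY π hmin q
  have H2 := h.bijective_id_add_comp hX' hY' π' hmin' q'
  refine ⟨LinearEquiv.ofBijective b ⟨fun z z' hz ↦ H1.1 ?_, fun z ↦ ?_⟩⟩
  · change z + π (q z) = z' + π (q z')
    rw [← h1, ← h1, hz]
  · obtain ⟨w, hw⟩ := H2.2 z
    exact ⟨b' w, (h2 w).trans hw⟩

/-- A module with no summand isomorphic to `W` may be cancelled against `W`. -/
theorem nonempty_linearEquiv_of_prod (h : CanonicalSetup R d W) (hA : ¬ SummandVia R W (LinearMap.id : A →ₗ[R] A))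
    (ψ : (W × A) ≃ₗ[R] (W × B)) : Nonempty (A ≃ₗ[R] B) := by
  let a : W →ₗ[R] W := LinearMap.fst R W B ∘ₗ ψ.toLinearMap ∘ₗ LinearMap.inl R W A
  let b : A →ₗ[R] W := LinearMap.fst R W B ∘ₗ ψ.toLinearMap ∘ₗ LinearMap.inr R W A
  let a' : W →ₗ[R] W := LinearMap.fst R W A ∘ₗ ψ.symm.toLinearMap ∘ₗ LinearMap.inl R W B
  let c' : W →ₗ[R] A := LinearMap.snd R W A ∘ₗ ψ.symm.toLinearMap ∘ₗ LinearMap.inl R W B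
  have hsum : a ∘ₗ a' + b ∘ₗ c' = LinearMap.id := by
    ext w
    change (ψ ((ψ.symm (w, 0)).1, 0)).1 + (ψ (0, (ψ.symm (w, 0)).2)).1 = w
    rw [← Prod.fst_add, ← map_add, Prod.mk_add_mk, add_zero, zero_add, Prod.mk.eta,
      ψ.apply_symm_apply]
  obtain ⟨e, he⟩ := @exists_ne _ h.nontrivial_topExt 0
  have h0 : topMap d (b ∘ₗ c') e = 0 := by
    by_contra hne
    exact hA ⟨c', b, h.bijective_of_topMap_ne_zero _ hne⟩
  refine _root_.nonempty_linearEquiv_of_prod ψ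
    (h.bijective_of_topMap_ne_zero a (e₀ := topMap d a' e) fun h1 ↦ he ?_)
  rw [← topMap_id d e, ← hsum, topMap_add, h0, topMap_comp, h1, add_zero]

/-- Comparison of a minimal approximation `0 → Y → X → M → 0` with an approximation
`0 → Y' → W × X' → M → 0` where `W` is not a summand of `X'`. -/
theorem nonempty_linearEquiv_or_of_approx (h : CanonicalSetup R d W) {M Y X Y' X' : Type} [AddCommGroup M] [AddCommGroup Y]
    [AddCommGroup X] [AddCommGroup Y'] [AddCommGroup X'] [Module R M] [Module R Y] [Module R X]
    [Module R Y'] [Module R X'] {ι : Y →ₗ[R] X} {π : X →ₗ[R] M} {ι' : Y' →ₗ[R] (W × X')}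
    {π' : (W × X') →ₗ[R] M} (he : Function.Exact ι π) (hι : Function.Injective ι)
    (hπ : Function.Surjective π) (he' : Function.Exact ι' π') (hι' : Function.Injective ι')
    (hπ' : Function.Surjective π') (hY : FID R Y) (hX : HasDepth R d X) (hY' : FID R Y')
    (hX' : HasDepth R d X') (hmin : ¬ SummandVia R W ι)
    (hW : ¬ SummandVia R W (LinearMap.id : X' →ₗ[R] X')) :
    Nonempty (X ≃ₗ[R] X') ∨ Nonempty (X ≃ₗ[R] (W × X')) := by
  have hZ := h.hasDepth.prod hX'
  obtain ⟨β, hβ⟩ := exists_lift he' hι' hπ' (h.ext_one hX hY') π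
  obtain ⟨β', hβ'⟩ := exists_lift he hι hπ (h.ext_one hZ hY) π'
  replace hβ := LinearMap.congr_fun hβ
  replace hβ' := LinearMap.congr_fun hβ'
  simp only [LinearMap.comp_apply] at hβ hβ'
  obtain ⟨q, hq⟩ := exists_corestrict he hι (β' ∘ₗ β - LinearMap.id) fun z ↦ by
    rw [LinearMap.sub_apply, map_sub, LinearMap.comp_apply, hβ', hβ, LinearMap.id_apply, sub_self]
  have H := h.bijective_id_add_comp hX hY ι hmin q
  have hH : ∀ z, z + ι (q z) = β' (β z) := fun z ↦ by
    rw [hq]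
    exact add_sub_cancel z (β' (β z))
  let ε := LinearEquiv.ofBijective _ H
  have hε : ∀ z, ε z = β' (β z) := hH
  have hπε : ∀ z, π (ε.symm z) = π z := fun z ↦ by
    obtain ⟨z, rfl⟩ := ε.surjective z
    rw [ε.symm_apply_apply, hε, hβ', hβ]
  let ρ : (W × X') →ₗ[R] X := ε.symm.toLinearMap ∘ₗ β'
  have hρ : ∀ z, ρ z = ε.symm (β' z) := fun _ ↦ rfl
  have hρβ : ∀ z, ρ (β z) = z := fun z ↦ by
    rw [hρ, ← hε, ε.symm_apply_apply]
  obtain ⟨k, hk⟩ := exists_corestrict he' hι' (LinearMap.id - β ∘ₗ ρ) fun z ↦ by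
    rw [LinearMap.sub_apply, map_sub, LinearMap.comp_apply, hβ, hρ, hπε, hβ',
      LinearMap.id_apply, sub_self]
  obtain ⟨m, u, v, rfl⟩ := h.exists_factor hZ hY' k
  let σ := splitEquiv ρ β hρβ
  let i : LinearMap.ker ρ →ₗ[R] (W × X') := (LinearMap.ker ρ).subtype
  let r : (W × X') →ₗ[R] LinearMap.ker ρ := LinearMap.snd R X (LinearMap.ker ρ) ∘ₗ σ.toLinearMap
  have hr : ∀ z, i (r z) = ι' (v (u z)) := fun z ↦ (hk z).symm
  have hri : ∀ z, r (i z) = z := fun z ↦ by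
    have hz : ρ (i z) = 0 := z.2
    apply Subtype.ext
    change i z - β (ρ (i z)) = i z
    rw [hz, map_zero, sub_zero]
  have hret : (r ∘ₗ ι' ∘ₗ v) ∘ₗ (u ∘ₗ i) = LinearMap.id := by
    ext z : 1
    change r (ι' (v (u (i z)))) = z
    rw [← hr, hri, hri]
  have hQ : HasDepth R d (LinearMap.ker ρ) := hZ.of_retract i r (LinearMap.ext hri)
  rcases subsingleton_or_nontrivial (LinearMap.ker ρ) with hs | hn
  · right
    refine ⟨(LinearEquiv.ofBijective ρ ⟨?_, fun z ↦ ⟨β z, hρβ z⟩⟩).symm⟩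
    rw [← LinearMap.ker_eq_bot, Submodule.eq_bot_of_subsingleton (p := LinearMap.ker ρ)]
  · left
    obtain ⟨s, p, hps⟩ := h.summand_of_retract hQ _ _ hret
    obtain ⟨η, hη⟩ := exists_section_of_bijective s p hps
    let τ := splitEquiv p (s ∘ₗ η) hη
    let Q := LinearMap.ker p
    let ψ : (W × X') ≃ₗ[R] (W × (Q × X)) :=
      σ.trans ((LinearEquiv.prodComm R X (LinearMap.ker ρ)).trans
        ((τ.prodCongr (LinearEquiv.refl R X)).trans (LinearEquiv.prodAssoc R W Q X)))
    obtain ⟨θ⟩ := h.nonempty_linearEquiv_of_prod (B := Q × X) hW ψ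
    let iQ : Q →ₗ[R] LinearMap.ker ρ := Q.subtype
    let rQ : LinearMap.ker ρ →ₗ[R] Q := LinearMap.snd R W Q ∘ₗ τ.toLinearMap
    have hrQ : rQ ∘ₗ iQ = LinearMap.id := by
      ext z : 1
      have hz : p (iQ z) = 0 := z.2
      apply Subtype.ext
      change iQ z - s (η (p (iQ z))) = iQ z
      rw [hz, map_zero, map_zero, sub_zero]
    have hQs : Subsingleton Q := by
      by_contra hns
      have := not_subsingleton_iff_nontrivial.1 hns
      obtain ⟨s', p', hps'⟩ := h.summand_of_retract (A := Q) (hQ.of_retract iQ rQ hrQ)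
        ((u ∘ₗ i) ∘ₗ iQ) (rQ ∘ₗ (r ∘ₗ ι' ∘ₗ v)) (by
          ext z : 1
          change rQ (((r ∘ₗ ι' ∘ₗ v) ∘ₗ (u ∘ₗ i)) (iQ z)) = z
          rw [hret]
          exact LinearMap.congr_fun hrQ z)
      refine hW ⟨θ.symm.toLinearMap ∘ₗ LinearMap.inl R Q X ∘ₗ s',
        p' ∘ₗ LinearMap.fst R Q X ∘ₗ θ.toLinearMap, ?_⟩
      convert hps' using 2
      ext w
      change p' (θ (θ.symm (s' w, 0))).1 = p' (s' w)
      rw [θ.apply_symm_apply]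
    have : Unique Q := ⟨⟨0⟩, fun _ ↦ Subsingleton.elim _ _⟩
    exact ⟨((LinearEquiv.uniqueProd (R := R) (M := X) (M₂ := Q)).symm.trans θ.symm)⟩

end CanonicalSetup
end Canonical

end Homological

section Assembly
open Abelian IsLocalRing
variable {R : Type} [CommRing R]

theorem HasFiniteInjDim.fid {Y : ModuleCat.{0} R} (h : HasFiniteInjDim R Y)
    (hY : Module.Finite R Y) : FID R Y := by
  obtain ⟨n, hn⟩ := h
  refine ⟨hY, n, fun N i hi ↦ ?_⟩
  obtain ⟨ε⟩ := modExt_nonempty_linearEquiv N Y i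
  have := hn N i hi
  exact ε.symm.toEquiv.subsingleton

theorem FID.hasFiniteInjDim {Y : Type} [AddCommGroup Y] [Module R Y] (h : FID R Y) :
    HasFiniteInjDim R (ModuleCat.of R Y) := by
  obtain ⟨n, hn⟩ := h.vanish
  refine ⟨n, fun N i hi ↦ ?_⟩
  obtain ⟨ε⟩ := modExt_nonempty_linearEquiv N (ModuleCat.of R Y) i
  have := hn N i hi
  exact ε.toEquiv.subsingleton

theorem exists_quotient_hull {ω : Ideal R} {Y X : Type} [AddCommGroup Y] [AddCommGroup X] [Module R Y]
    [Module R X] {ι : R →ₗ[R] Y} {π : Y →ₗ[R] X} (he : Function.Exact ι π)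
    (hι : Function.Injective ι) (hπ : Function.Surjective π) (hω : FID R ω) (hY : FID R Y) :
    ∃ (Y' : Type) (_ : AddCommGroup Y') (_ : Module R Y') (ι' : (R ⧸ ω) →ₗ[R] Y')
      (π' : Y' →ₗ[R] X), Function.Exact ι' π' ∧ Function.Injective ι' ∧ Function.Surjective π' ∧
      FID R Y' := by
  let S : Submodule R Y := Submodule.map ι ω
  let ι' : (R ⧸ ω) →ₗ[R] (Y ⧸ S) := Submodule.mapQ ω S ι (Submodule.le_comap_map ι ω)
  have hS : S ≤ LinearMap.ker π := by
    rintro _ ⟨r, -, rfl⟩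
    exact he.apply_apply_eq_zero r
  let π' : (Y ⧸ S) →ₗ[R] X := S.liftQ π hS
  have hι' : ∀ r, ι' (ω.mkQ r) = S.mkQ (ι r) := fun _ ↦ rfl
  have hπ' : ∀ y, π' (S.mkQ y) = π y := fun _ ↦ rfl
  refine ⟨Y ⧸ S, inferInstance, inferInstance, ι', π', fun y ↦ ?_, ?_, fun z ↦ ?_, ?_⟩
  · obtain ⟨y, rfl⟩ := S.mkQ_surjective y
    rw [hπ']
    constructor
    · intro hy
      obtain ⟨r, rfl⟩ := (he y).1 hy
      exact ⟨ω.mkQ r, hι' r⟩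
    · rintro ⟨r, hr⟩
      obtain ⟨r, rfl⟩ := ω.mkQ_surjective r
      rw [← hπ', ← hr, hι', hπ', he.apply_apply_eq_zero]
  · rw [injective_iff_map_eq_zero]
    intro r hr
    obtain ⟨r, rfl⟩ := ω.mkQ_surjective r
    rw [hι', Submodule.mkQ_apply, Submodule.Quotient.mk_eq_zero] at hr
    obtain ⟨r', hr', h⟩ := hr
    rw [Submodule.mkQ_apply, Submodule.Quotient.mk_eq_zero, ← hι h]
    exact hr'
  · obtain ⟨y, rfl⟩ := hπ z
    exact ⟨S.mkQ y, rfl⟩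
  · refine FID.of_exact_right (f := ι ∘ₗ ω.subtype) (g := S.mkQ) ?_
      (hι.comp (Submodule.injective_subtype ω)) S.mkQ_surjective hω hY
    rw [LinearMap.exact_iff, Submodule.ker_mkQ, LinearMap.range_comp, Submodule.range_subtype]

theorem exists_approx_of_hull {ω : Ideal R} {Y X : Type} [AddCommGroup Y] [AddCommGroup X] [Module R Y]
    [Module R X] {ι : R →ₗ[R] Y} {π : Y →ₗ[R] X} (he : Function.Exact ι π)
    (hι : Function.Injective ι) (hπ : Function.Surjective π)
    (hExt : Subsingleton (Ext (ModuleCat.of R X) (ModuleCat.of R ω) 1)) {x : R} (hxω : x ∈ ω)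
    (hx : x ∈ nonZeroDivisors R) :
    ∃ (ι' : Y →ₗ[R] (ω × X)) (π' : (ω × X) →ₗ[R] qmod R ω (Ideal.span {x})),
      Function.Exact ι' π' ∧ Function.Injective ι' ∧ Function.Surjective π' := by
  obtain ⟨g, hg⟩ := exists_extension he hι hπ hExt (LinearMap.toSpanSingleton R ω ⟨x, hxω⟩)
  have hgι : ∀ r, (g (ι r) : R) = r * x := fun r ↦
    congrArg Subtype.val (LinearMap.congr_fun hg r)
  let S : Submodule R ω := Submodule.comap ω.subtype (Ideal.span {x})
  have hS : ∀ w : ω, S.mkQ w = 0 ↔ ∃ r, (w : R) = r * x := fun w ↦ by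
    rw [Submodule.mkQ_apply, Submodule.Quotient.mk_eq_zero]
    change (w : R) ∈ Ideal.span {x} ↔ _
    rw [Ideal.mem_span_singleton']
    exact exists_congr fun _ ↦ eq_comm
  let θ : (ω × Y) →ₗ[R] (ω ⧸ S) :=
    S.mkQ ∘ₗ (LinearMap.fst R ω Y - g ∘ₗ LinearMap.snd R ω Y)
  have hθ : ∀ w y, θ (w, y) = S.mkQ (w - g y) := fun _ _ ↦ rfl
  have hex : Function.Exact (LinearMap.inr R ω Y ∘ₗ ι) (LinearMap.prodMap LinearMap.id π :
      (ω × Y) →ₗ[R] (ω × X)) := by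
    rintro ⟨w, y⟩
    constructor
    · intro h
      obtain ⟨r, rfl⟩ := (he y).1 (congrArg Prod.snd h)
      exact ⟨r, Prod.ext (congrArg Prod.fst h).symm rfl⟩
    · rintro ⟨r, hr⟩
      rw [← hr]
      exact Prod.ext rfl (he.apply_apply_eq_zero r)
  obtain ⟨c, hc⟩ := exists_desc hex (g := LinearMap.prodMap LinearMap.id π)
    (Function.Surjective.prodMap Function.surjective_id hπ) θ fun r ↦ by
      change θ (0, ι r) = 0
      rw [hθ, hS]
      refine ⟨-r, ?_⟩
      change (0 : R) - (g (ι r) : R) = _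
      rw [hgι, zero_sub, neg_mul]
  have hc' : ∀ w y, c (w, π y) = S.mkQ (w - g y) := fun w y ↦ hc (w, y)
  refine ⟨g.prod π, c, ?_, ?_, fun q ↦ ?_⟩
  · rintro ⟨w, z⟩
    obtain ⟨y, rfl⟩ := hπ z
    constructor
    · intro h
      obtain ⟨r, hr⟩ := (hS _).1 ((hc' w y).symm.trans h)
      refine ⟨y + ι r, Prod.ext ?_ ?_⟩
      · change g (y + ι r) = w
        apply Subtype.ext
        have hr' : (w : R) - g y = r * x := hr
        rw [map_add, Submodule.coe_add, hgι, ← hr', add_sub_cancel]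
      · change π (y + ι r) = π y
        rw [map_add, he.apply_apply_eq_zero, add_zero]
    · rintro ⟨y', hy'⟩
      rw [← hy']
      change c (g y', π y') = 0
      rw [hc', sub_self, map_zero]
  · rw [injective_iff_map_eq_zero]
    intro y hy
    obtain ⟨r, rfl⟩ := (he y).1 (congrArg Prod.snd hy)
    have h0 : r * x = 0 := by
      rw [← hgι]
      exact congrArg (fun z : ω × X ↦ (z.1 : R)) hy
    rw [(mul_right_mem_nonZeroDivisors_eq_zero_iff hx).1 h0, map_zero]
  · obtain ⟨w, rfl⟩ := S.mkQ_surjective q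
    refine ⟨(w, π 0), ?_⟩
    rw [hc', map_zero, sub_zero]

theorem subsingleton_of_linearEquiv_prod {W A : Type} [AddCommGroup W] [AddCommGroup A]
    [Module R W] [Module R A] [IsNoetherianRing R] [Module.Finite R A] (ε : A ≃ₗ[R] W × A) :
    Subsingleton W := by
  have hinj := OrzechProperty.injective_of_surjective_endomorphism
    (LinearMap.snd R W A ∘ₗ ε.toLinearMap) (by
      rw [LinearMap.coe_comp]
      exact LinearMap.snd_surjective.comp ε.surjective)
  refine subsingleton_of_forall_eq 0 fun w ↦ ?_
  have : ε.symm (w, 0) = ε.symm 0 := hinj (by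
    change (ε (ε.symm (w, 0))).2 = (ε (ε.symm 0)).2
    rw [ε.apply_symm_apply, ε.apply_symm_apply]
    rfl)
  exact congrArg Prod.fst (ε.symm.injective this)

variable [IsLocalRing R]

theorem moduleDepth_eq {d : ℕ} {M : ModuleCat.{0} R} (hd : ringKrullDim R = d)
    (h : (moduleDepth R M : WithBot ℕ∞) = ringKrullDim R) : moduleDepth R M = d := by
  rw [hd] at h
  exact_mod_cast h

theorem depthGE_of_moduleDepth_eq {d : ℕ} {M : ModuleCat.{0} R} (h : moduleDepth R M = d) :
    DepthGE d M := by
  intro i hi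
  obtain ⟨ε⟩ := modExt_nonempty_linearEquiv (resField R) M i
  by_contra hn
  have := not_subsingleton_iff_nontrivial.1 hn
  have hle : moduleDepth R M ≤ i := sInf_le ⟨i, rfl, ε.toEquiv.nontrivial⟩
  rw [h, Nat.cast_le] at hle
  omega

theorem nontrivial_of_moduleDepth_eq {d : ℕ} {M : ModuleCat.{0} R} (h : moduleDepth R M = d) :
    Nontrivial (Ext (resField R) M d) := by
  obtain ⟨ε⟩ := modExt_nonempty_linearEquiv (resField R) M d
  have hne : Set.Nonempty {n : ℕ∞ | ∃ m : ℕ, n = (m : ℕ∞) ∧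
      Nontrivial (ModExt R m (ModuleCat.of R (ResidueField R)) M)} := by
    by_contra hne
    rw [moduleDepth, Set.not_nonempty_iff_eq_empty.1 hne, sInf_empty] at h
    exact ENat.top_ne_natCast d h
  obtain ⟨m, hm, hnt⟩ := csInf_mem hne
  obtain rfl : m = d := by exact_mod_cast hm.symm.trans h
  exact ε.symm.toEquiv.nontrivial

theorem IsMCM.hasDepth {d : ℕ} (hd : ringKrullDim R = d) {X : ModuleCat.{0} R} (h : IsMCM R X) :
    HasDepth R d X :=
  ⟨h.1, depthGE_of_moduleDepth_eq (moduleDepth_eq hd h.2)⟩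

theorem hasDepth_of_isMCM_or {d : ℕ} (hd : ringKrullDim R = d) {X : ModuleCat.{0} R}
    (h : IsMCM R X ∨ Subsingleton X) : HasDepth R d X := by
  rcases h with h | h
  · exact h.hasDepth hd
  · exact ⟨inferInstance, fun i _ ↦ subsingleton_ext_of_subsingleton_right i h⟩

theorem IsCanonicalIdeal.canonicalSetup (hCM : IsCMLocalRing R) (hnG : ¬ IsGorensteinLocalRing R)
    {ω : Ideal R} (hω : IsCanonicalIdeal R ω) {x : R} (hxω : x ∈ ω)
    (hx : x ∈ nonZeroDivisors R) : ∃ d : ℕ, ringKrullDim R = d ∧ CanonicalSetup R d ω := by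
  have hN := hCM.1
  obtain ⟨hfin, hfid, d, hd, ⟨ε⟩, hvan⟩ := hω
  have hfid' := hfid.fid hfin
  obtain ⟨δ⟩ := modExt_nonempty_linearEquiv (resField R) (ModuleCat.of R ω) d
  have hdR := moduleDepth_eq hd hCM.2
  refine ⟨d, hd, ?_, hd, depthGE_of_moduleDepth_eq hdR, nontrivial_of_moduleDepth_eq hdR, hfid',
    fun i hi ↦ ?_, ⟨δ.symm.trans ε⟩⟩
  · rw [Nat.pos_iff_ne_zero]
    rintro rfl
    have hdim : Ring.KrullDimLE 0 R := by
      rw [Ring.krullDimLE_iff, hd]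
    have : IsArtinianRing R := isArtinianRing_iff_isNoetherianRing_krullDimLE_zero.2 ⟨hN, hdim⟩
    have htop : ω = ⊤ :=
      Ideal.eq_top_of_isUnit_mem ω hxω (IsArtinianRing.isUnit_of_mem_nonZeroDivisors hx)
    subst htop
    refine hnG ⟨hN, inferInstance, FID.hasFiniteInjDim (FID.of_retract hfid'
      (Submodule.topEquiv (R := R) (M := R)).symm.toLinearMap
      (Submodule.topEquiv (R := R) (M := R)).toLinearMap ?_)⟩
    ext
    rfl
  · obtain ⟨η⟩ := modExt_nonempty_linearEquiv (resField R) (ModuleCat.of R ω) i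
    have := hvan i hi.ne
    exact η.symm.toEquiv.subsingleton

end Assembly

theorem stmt0 (R : Type) [CommRing R] [IsLocalRing R]
    (hCM : IsCMLocalRing R) (hGG : IsGenericallyGorenstein R)
    (hnG : ¬ IsGorensteinLocalRing R)
    (ω : Ideal R) (hω : IsCanonicalIdeal R ω)
    (x : R) (hxω : x ∈ ω) (hxreg : x ∈ nonZeroDivisors R)
    (Y₁ X₁ : ModuleCat R) (ι₁ : Y₁ →ₗ[R] X₁) (π₁ : X₁ →ₗ[R] qmod R ω (Ideal.span {x}))
    (h₁ : IsMinMCMApprox R (qmod R ω (Ideal.span {x})) Y₁ X₁ ι₁ π₁)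
    (Y₂ X₂ : ModuleCat R) (ι₂ : (ModuleCat.of R (R ⧸ ω)) →ₗ[R] Y₂) (π₂ : Y₂ →ₗ[R] X₂)
    (h₂ : IsMinFIDHull R (ModuleCat.of R (R ⧸ ω)) Y₂ X₂ ι₂ π₂)
    (Y₃ X₃ : ModuleCat R) (ι₃ : (ModuleCat.of R R) →ₗ[R] Y₃) (π₃ : Y₃ →ₗ[R] X₃)
    (h₃ : IsMinFIDHull R (ModuleCat.of R R) Y₃ X₃ ι₃ π₃) :
    ((Nonempty (X₁ ≃ₗ[R] X₂) ∧ Nonempty (X₂ ≃ₗ[R] X₃)) ∨ (Nonempty (X₁ ≃ₗ[R] X₂) ∧ Nonempty (X₂ ≃ₗ[R] (↥ω × X₃))) ∨ (Nonempty (X₁ ≃ₗ[R] (↥ω × X₂)) ∧ Nonempty ((↥ω × X₂) ≃ₗ[R] (↥ω × X₃)))) ∧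
      ¬ ((Nonempty (X₁ ≃ₗ[R] X₂) ∧ Nonempty (X₂ ≃ₗ[R] X₃)) ∧ (Nonempty (X₁ ≃ₗ[R] X₂) ∧ Nonempty (X₂ ≃ₗ[R] (↥ω × X₃)))) ∧ ¬ ((Nonempty (X₁ ≃ₗ[R] X₂) ∧ Nonempty (X₂ ≃ₗ[R] X₃)) ∧ (Nonempty (X₁ ≃ₗ[R] (↥ω × X₂)) ∧ Nonempty ((↥ω × X₂) ≃ₗ[R] (↥ω × X₃)))) ∧ ¬ ((Nonempty (X₁ ≃ₗ[R] X₂) ∧ Nonempty (X₂ ≃ₗ[R] (↥ω × X₃))) ∧ (Nonempty (X₁ ≃ₗ[R] (↥ω × X₂)) ∧ Nonempty ((↥ω × X₂) ≃ₗ[R] (↥ω × X₃)))) := by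
  have hN := hCM.1
  obtain ⟨d, hd, h⟩ := hω.canonicalSetup hCM hnG hxω hxreg
  have hω₀ : Nontrivial ω := by
    refine ⟨⟨x, hxω⟩, 0, fun h0 ↦ nonZeroDivisors.ne_zero hxreg (congrArg Subtype.val h0)⟩
  obtain ⟨⟨-, hY₁, hX₁, hI₁, hι₁, hπ₁, he₁⟩, hm₁⟩ := h₁
  obtain ⟨⟨-, hY₂, hI₂, hX₂, hι₂, hπ₂, he₂⟩, hm₂⟩ := h₂
  obtain ⟨⟨-, hY₃, hI₃, hX₃, hι₃, hπ₃, he₃⟩, hm₃⟩ := h₃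
  replace hX₁ := hX₁.hasDepth hd
  replace hX₂ := hasDepth_of_isMCM_or hd hX₂
  replace hX₃ := hasDepth_of_isMCM_or hd hX₃
  replace hI₁ := hI₁.fid hY₁
  replace hI₂ := hI₂.fid hY₂
  replace hI₃ := hI₃.fid hY₃
  have hW := h.not_summand_of_minimal he₃ hι₃ hπ₃ ⟨inferInstance, h.depth_ring⟩ hX₃ hI₃
    (not_summandVia_of_minimal hm₃)
  have h23 : Nonempty (X₂ ≃ₗ[R] X₃) := by
    obtain ⟨Y', _, _, ι', π', he', hι', hπ', hI'⟩ := exists_quotient_hull he₃ hι₃ hπ₃ h.fid hI₃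
    exact h.nonempty_linearEquiv_of_hulls he₂ hι₂ hπ₂ he' hι' hπ' hI₂ hX₂ hI' hX₃
      (not_summandVia_of_minimal hm₂) fun hs ↦ hW hs.target
  have h13 : Nonempty (X₁ ≃ₗ[R] X₃) ∨ Nonempty (X₁ ≃ₗ[R] (ω × X₃)) := by
    obtain ⟨ι', π', he', hι', hπ'⟩ :=
      exists_approx_of_hull he₃ hι₃ hπ₃ (h.ext_one hX₃ h.fid) hxω hxreg
    exact h.nonempty_linearEquiv_or_of_approx he₁ hι₁ hπ₁ he' hι' hπ' hI₁ hX₁ hI₃ hX₃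
      (not_summandVia_of_minimal hm₁) hW
  have hfin₂ := hX₂.finite
  have hno : ∀ A : ModuleCat R, Module.Finite R A → ¬ Nonempty (A ≃ₗ[R] (ω × A)) :=
    fun A _ ⟨ε⟩ ↦ not_subsingleton ω (subsingleton_of_linearEquiv_prod ε)
  obtain ⟨e⟩ := h23
  refine ⟨?_, ?_, ?_, ?_⟩
  · rcases h13 with ⟨⟨f⟩⟩ | ⟨⟨f⟩⟩
    · exact Or.inl ⟨⟨f.trans e.symm⟩, ⟨e⟩⟩
    · let e' : (ω × X₂) ≃ₗ[R] (ω × X₃) := (LinearEquiv.refl R ω).prodCongr e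
      exact Or.inr (Or.inr ⟨⟨f.trans e'.symm⟩, ⟨e'⟩⟩)
  · rintro ⟨-, -, ⟨f⟩⟩
    exact hno X₂ hfin₂ ⟨f.trans ((LinearEquiv.refl R ω).prodCongr e.symm)⟩
  · rintro ⟨⟨⟨f⟩, -⟩, ⟨g⟩, -⟩
    exact hno X₂ hfin₂ ⟨f.symm.trans g⟩
  · rintro ⟨⟨⟨f⟩, -⟩, ⟨g⟩, -⟩
    exact hno X₂ hfin₂ ⟨f.symm.trans g⟩

end
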